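/- Let v be a nonempty cyclically reduced, cyclically alternating word in F which represents the trivial element of Heck(r;n) = ⟨a, b | u_r^n⟩. Then the cyclic word (v) contains a subword w of the cyclic word (u_r^n) or of (u_r^{−n}) such that S(w) = ((2n−1)⟨S_1, S_2⟩, ℓ) or S(w) = (ℓ, (2n−1)⟨S_2, S_1⟩) for some positive integer ℓ. -/

import Mathlib

/- Formalization of statements from "Homotopically equivalent simple loops on
2-bridge spheres in Heckoid orbifolds for 2-bridge links (II)" by Lee-Sakuma.

We work in the free group `F` on two generators `a = gen 0`, `b = gen 1`.
For a rational `s` (in lowest terms `q/p`, with `0 ≤ s ≤ 1`), `uWord s` is the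
word `u_s = a b^{ε₁} a^{ε₂} ⋯ b^{ε_{2p-1}}` with `ε_i = (-1)^⌊i·s⌋`.
`CS s` is (a linear representative of) the cyclic sequence of lengths of
maximal constant-sign runs of exponents of `u_s`; since `u_s` begins with a
positive letter and (for `0 < s ≤ 1`) ends with a negative letter, the linear
run-length sequence represents the cyclic one.  `CyclicContains L T` says the
cyclic sequence represented by `L` contains `T` as a block of consecutive
terms.  `cfQ [m₁,…,m_k]` is the continued fraction `1/(m₁+1/(m₂+⋯+1/m_k))`.
`memI1 M n s` / `memI2 M n s` express `s ∈ I₁(r;n)` / `s ∈ I₂(r;n)` where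
`r = cfQ M`, and `memI1hat` / `memI2hat` express `s ∈ I₁(r)` / `s ∈ I₂(r)`.
The Heckoid group `Heck(r;n) = ⟨a,b | u_r^n⟩` is the quotient of `F` by the
normal closure `heckN r n` of `u_r^n`, with quotient map `heckQ r n`. -/

namespace Heckoid

abbrev F : Type := FreeGroup (Fin 2)

/-- The generators: `gen 0 = a`, `gen 1 = b` (and `gen i` depends on parity). -/
def gen (i : ℕ) : F := FreeGroup.of ⟨i % 2, Nat.mod_lt _ (by norm_num)⟩

/-- The word `u_s = a b^{ε₁} a^{ε₂} b^{ε₃} ⋯ a^{ε_{2p-2}} b^{ε_{2p-1}}`,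
where `s = q/p` in lowest terms and `ε_i = (-1)^⌊iq/p⌋`. -/
def uWord (s : ℚ) : F :=
  ((List.range (2 * s.den)).map
    (fun i => gen i ^ ((-1 : ℤ) ^ (⌊(i : ℚ) * s⌋.toNat)))).prod

/-- The sequence of exponent signs `ε₀, ε₁, …, ε_{2p-1}` of `u_s`. -/
def signList (s : ℚ) : List ℤ :=
  (List.range (2 * s.den)).map (fun i => (-1 : ℤ) ^ (⌊(i : ℚ) * s⌋.toNat))

/-- Lengths of the maximal runs of equal consecutive entries. -/
def runLengths {α : Type} [BEq α] (l : List α) : List ℕ :=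
  (l.splitBy (· == ·)).map List.length

/-- `CS s = CS(u_s)`: the cyclic sequence of lengths of maximal constant-sign
runs of `u_s`, represented by a list. -/
def CS (s : ℚ) : List ℕ := runLengths (signList s)

/-- The cyclic sequence represented by `L` contains `T` as a block of
consecutive terms. -/
def CyclicContains (L T : List ℕ) : Prop := ∃ k, T <+: L.rotate k

/-- The continued fraction `[m₁, m₂, …, m_k] = 1/(m₁+1/(m₂+⋯+1/m_k))`. -/
def cfQ : List ℕ → ℚ
  | [] => 0
  | a :: l => 1 / ((a : ℚ) + cfQ l)

/-- `d⟨T, T'⟩`: `d` consecutive repetitions of the concatenation of `T` and `T'`. -/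
def rep2 (d : ℕ) (T T' : List ℕ) : List ℕ := (List.replicate d (T ++ T')).flatten

/-- `s ∈ I₁(r;n)` where `r = cfQ M`:  `[0, [m₁,…,m_{k-1},m_k-1,2]]` for `k` even,
`[0, [m₁,…,m_k,2n-2])` for `k` odd. -/
def memI1 (M : List ℕ) (n : ℕ) (s : ℚ) : Prop :=
  if Even M.length then 0 ≤ s ∧ s ≤ cfQ (M.dropLast ++ [M.getLast! - 1, 2])
  else 0 ≤ s ∧ s < cfQ (M ++ [2 * n - 2])

/-- `s ∈ I₂(r;n)` where `r = cfQ M`: `([m₁,…,m_k,2n-2], 1]` for `k` even,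
`[[m₁,…,m_{k-1},m_k-1,2], 1]` for `k` odd. -/
def memI2 (M : List ℕ) (n : ℕ) (s : ℚ) : Prop :=
  if Even M.length then cfQ (M ++ [2 * n - 2]) < s ∧ s ≤ 1
  else cfQ (M.dropLast ++ [M.getLast! - 1, 2]) ≤ s ∧ s ≤ 1

/-- `s ∈ I₁(r)` where `r = cfQ M`. -/
def memI1hat (M : List ℕ) (s : ℚ) : Prop :=
  if Even M.length then 0 ≤ s ∧ s ≤ cfQ (M.dropLast ++ [M.getLast! - 1])
  else 0 ≤ s ∧ s ≤ cfQ M.dropLast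

/-- `s ∈ I₂(r)` where `r = cfQ M`. -/
def memI2hat (M : List ℕ) (s : ℚ) : Prop :=
  if Even M.length then cfQ M.dropLast ≤ s ∧ s ≤ 1
  else cfQ (M.dropLast ++ [M.getLast! - 1]) ≤ s ∧ s ≤ 1

/-- The normal closure of `u_r^n`, so that `Heck(r;n) = F ⧸ heckN r n`. -/
abbrev heckN (r : ℚ) (n : ℕ) : Subgroup F := Subgroup.normalClosure {uWord r ^ n}

/-- The quotient map `F → Heck(r;n) = ⟨a, b | u_r^n⟩`. -/
def heckQ (r : ℚ) (n : ℕ) : F →* F ⧸ heckN r n := QuotientGroup.mk' (heckN r n)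

/-- A word is cyclically alternating: reading cyclically, consecutive letters
involve different generators. -/
def CycAlternating (w : List (Fin 2 × Bool)) : Prop :=
  ∀ i : Fin w.length,
    (w.get i).1 ≠ (w.get ⟨(i.val + 1) % w.length, Nat.mod_lt _ i.pos⟩).1

/-- A word is cyclically reduced: all of its cyclic permutations are reduced. -/
def CycReduced (w : List (Fin 2 × Bool)) : Prop :=
  ∀ k, FreeGroup.reduce (w.rotate k) = w.rotate k

open FreeGroup (invRev)

/-! ### Products of conjugates -/

/-- `ConjProd xs y` says that `y` is a product of conjugates of the entries of `xs`, in order. -/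
inductive ConjProd {G : Type*} [Group G] : List G → G → Prop
  | nil : ConjProd [] 1
  | cons (g x : G) {xs : List G} {y : G} (h : ConjProd xs y) :
      ConjProd (x :: xs) (g * x * g⁻¹ * y)

namespace ConjProd

variable {G H : Type*} [Group G] [Group H]

theorem conj {xs : List G} {y : G} (h : ConjProd xs y) (c : G) :
    ConjProd xs (c * y * c⁻¹) := by
  induction h with
  | nil => simpa using ConjProd.nil
  | cons g x _ ih =>
    have := ConjProd.cons (c * g) x ih
    convert this using 1
    group

theorem map {xs : List G} {y : G} (h : ConjProd xs y) (f : G →* H) :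
    ConjProd (xs.map f) (f y) := by
  induction h with
  | nil => simpa using ConjProd.nil
  | cons g x _ ih => simpa using ConjProd.cons (f g) (f x) ih

theorem filter_ne_one [DecidableEq G] {xs : List G} {y : G} (h : ConjProd xs y) :
    ConjProd (xs.filter (· ≠ 1)) y := by
  induction h with
  | nil => exact ConjProd.nil
  | cons g x _ ih =>
    by_cases hx : x = 1
    · subst hx; simpa using ih
    · rw [List.filter_cons_of_pos (by simpa using hx)]
      exact ConjProd.cons g x ih

theorem append {xs ys : List G} {x y : G} (hx : ConjProd xs x) (hy : ConjProd ys y) :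
    ConjProd (xs ++ ys) (x * y) := by
  induction hx with
  | nil => simpa using hy
  | cons g x _ ih =>
    rw [mul_assoc]
    exact ConjProd.cons g x ih

theorem inv {xs : List G} {y : G} (h : ConjProd xs y) :
    ConjProd (xs.map (·⁻¹)).reverse y⁻¹ := by
  induction h with
  | nil => simpa using ConjProd.nil
  | cons g x _ ih =>
    have := ih.append (ConjProd.cons g x⁻¹ ConjProd.nil)
    simpa [mul_assoc] using this

theorem exists_of_mem_normalClosure {r y : G} (h : y ∈ Subgroup.normalClosure {r}) :
    ∃ xs : List G, (∀ x ∈ xs, x = r ∨ x = r⁻¹) ∧ ConjProd xs y := by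
  induction h using Subgroup.closure_induction with
  | mem x hx =>
    obtain ⟨a, ha, hax⟩ := Group.mem_conjugatesOfSet_iff.1 hx
    obtain ⟨c, hc⟩ := isConj_iff.1 hax
    refine ⟨[r], by simp, ?_⟩
    have := ConjProd.cons c r ConjProd.nil
    rw [Set.mem_singleton_iff.1 ha] at hc
    simpa [hc] using this
  | one => exact ⟨[], by simp, ConjProd.nil⟩
  | mul x y _ _ hx hy =>
    obtain ⟨xs, h1, h2⟩ := hx
    obtain ⟨ys, h3, h4⟩ := hy
    refine ⟨xs ++ ys, fun z hz => ?_, h2.append h4⟩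
    rcases List.mem_append.1 hz with hz | hz
    exacts [h1 z hz, h3 z hz]
  | inv x _ hx =>
    obtain ⟨xs, h1, h2⟩ := hx
    refine ⟨_, fun z hz => ?_, h2.inv⟩
    simp only [List.mem_reverse, List.mem_map] at hz
    obtain ⟨z, hz, rfl⟩ := hz
    rcases h1 z hz with rfl | rfl
    · exact Or.inr rfl
    · left; simp

end ConjProd

/-! ### Oriented edges and paths -/

/-- The inverse of a letter, or of an oriented edge. -/
def flip {α : Type*} (d : α × Bool) : α × Bool := (d.1, !d.2)

section flip
variable {α : Type*}

@[simp] theorem flip_flip (d : α × Bool) : flip (flip d) = d := by simp [flip]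

@[simp] theorem flip_fst (d : α × Bool) : (flip d).1 = d.1 := rfl

theorem flip_ne (d : α × Bool) : flip d ≠ d := by
  intro h; simpa [flip] using congrArg Prod.snd h

theorem flip_injective : Function.Injective (flip : α × Bool → α × Bool) :=
  (show Function.Involutive flip from flip_flip).injective

theorem invRev_eq (l : List (α × Bool)) : invRev l = (l.map flip).reverse := rfl

theorem mem_invRev {l : List (α × Bool)} {d : α × Bool} : d ∈ invRev l ↔ flip d ∈ l := by
  rw [invRev_eq, List.mem_reverse, List.mem_map]
  exact ⟨fun ⟨a, ha, h⟩ => by rwa [← h, flip_flip], fun h => ⟨_, h, flip_flip d⟩⟩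

theorem map_invRev {β : Type*} (f : α × Bool → β × Bool) (hf : ∀ d, f (flip d) = flip (f d))
    (l : List (α × Bool)) : (invRev l).map f = invRev (l.map f) := by
  simp [invRev_eq, List.map_reverse, hf, Function.comp_def]

theorem mk_cons_flip (c : α × Bool) (l : List (α × Bool)) :
    FreeGroup.mk (c :: flip c :: l) = FreeGroup.mk l :=
  Quot.sound (by simpa [flip] using FreeGroup.Red.Step.cons_not (x := c.1) (b := c.2) (L := l))

/-- The homomorphism of free groups given by a map of letters compatible with inversion. -/
theorem lift_mk_eq {β : Type*} (f : α × Bool → β × Bool) (hf : ∀ d, f (flip d) = flip (f d))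
    (l : List (α × Bool)) :
    FreeGroup.lift (fun a => FreeGroup.mk [f (a, true)]) (FreeGroup.mk l)
      = FreeGroup.mk (l.map f) := by
  induction l with
  | nil => rfl
  | cons d l ih =>
    have h1 : FreeGroup.mk (d :: l) = FreeGroup.mk [d] * FreeGroup.mk l := by
      simp
    have h2 : FreeGroup.mk ((d :: l).map f) = FreeGroup.mk [f d] * FreeGroup.mk (l.map f) := by
      simp
    rw [h1, h2, map_mul, ih]
    congr 1
    obtain ⟨a, b⟩ := d
    cases b
    · have := hf (a, true)
      simp only [flip, Bool.not_true] at this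
      simp [this, FreeGroup.inv_mk, FreeGroup.invRev]
    · simp

end flip

/-- `IsPath src x l y` says that the list `l` of oriented edges is a path from `x` to `y`,
where `src` gives the initial vertex of an oriented edge. -/
def IsPath {α : Type*} (src : α × Bool → ℕ) : ℕ → List (α × Bool) → ℕ → Prop
  | x, [], y => x = y
  | x, d :: l, y => src d = x ∧ IsPath src (src (flip d)) l y

namespace IsPath
variable {α β : Type*} {src : α × Bool → ℕ}

theorem append {l l' : List (α × Bool)} {x y : ℕ} :
    IsPath src x (l ++ l') y ↔ ∃ z, IsPath src x l z ∧ IsPath src z l' y := by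
  induction l generalizing x with
  | nil => simp [IsPath]
  | cons d l ih => simp [IsPath, ih, and_assoc]

theorem invRev {l : List (α × Bool)} {x y : ℕ} (h : IsPath src x l y) :
    IsPath src y (FreeGroup.invRev l) x := by
  induction l generalizing x with
  | nil => simpa [IsPath] using Eq.symm h
  | cons d l ih =>
    rw [FreeGroup.invRev_cons]
    refine append.2 ⟨_, ih h.2, ?_⟩
    simpa [IsPath, FreeGroup.invRev, flip] using h.1

/-- Transport of a path along a map of edges and a map of vertices. -/
theorem map {src' : β × Bool → ℕ} (f : α × Bool → β × Bool) (q : ℕ → ℕ)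
    {l : List (α × Bool)} (hf : ∀ d ∈ l, f (flip d) = flip (f d))
    (hs : ∀ d ∈ l, src' (f d) = q (src d))
    (hs' : ∀ d ∈ l, src' (f (flip d)) = q (src (flip d)))
    {x y : ℕ} (h : IsPath src x l y) : IsPath src' (q x) (l.map f) (q y) := by
  induction l generalizing x with
  | nil => simpa [IsPath] using congrArg q h
  | cons d l ih =>
    refine ⟨by rw [hs d (by simp), h.1], ?_⟩
    rw [← hf d (by simp), hs' d (by simp)]
    exact ih (fun d hd => hf d (by simp [hd])) (fun d hd => hs d (by simp [hd]))
      (fun d hd => hs' d (by simp [hd])) h.2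

theorem getElem {l : List (α × Bool)} {x y : ℕ} (h : IsPath src x l y) (i : ℕ)
    (hi : i + 1 < l.length) : src l[i + 1] = src (flip l[i]) := by
  induction l generalizing x i with
  | nil => simp at hi
  | cons d l ih =>
    cases i with
    | zero =>
      cases l with
      | nil => simp at hi
      | cons e l => exact h.2.1
    | succ i => simpa using ih h.2 i (by simpa using hi)

theorem getElem_last {l : List (α × Bool)} {x y : ℕ} (h : IsPath src x l y)
    (hl : 0 < l.length) : src l[0] = x ∧ src (flip (l[l.length - 1]'(by omega))) = y := by
  induction l generalizing x with
  | nil => simp at hl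
  | cons d l ih =>
    refine ⟨h.1, ?_⟩
    cases l with
    | nil => simpa [IsPath] using h.2
    | cons e l => simpa using (ih h.2 (by simp)).2

end IsPath

/-! ### Spherical diagrams -/

/-- The oriented edges occurring on the boundaries of the faces `fs` and of an outer face
with boundary inverse to `o`. -/
def usedEdges (o : List (ℕ × Bool)) (fs : List (List (ℕ × Bool))) : List (ℕ × Bool) :=
  invRev o ++ fs.flatten

/-- A diagram on the sphere over a free group: polygons `fs` together with an outer polygon
glued along edges, the boundary of the outer polygon being inverse to the closed path `o`.
Oriented edges are elements of `ℕ × Bool`, and each occurs at most once on the boundary of a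
polygon. The map `src` sends an oriented edge to its initial vertex, and `lab` is the labelling. -/
structure Diagram (α : Type*) where
  /-- the boundary path of the diagram -/
  o : List (ℕ × Bool)
  /-- the boundary paths of the faces -/
  fs : List (List (ℕ × Bool))
  /-- the labelling of oriented edges -/
  lab : ℕ × Bool → α × Bool
  /-- the initial vertices of oriented edges -/
  src : ℕ × Bool → ℕ
  lab_flip : ∀ d, lab (flip d) = flip (lab d)
  nodup : (usedEdges o fs).Nodup
  closed : ∀ d ∈ usedEdges o fs, flip d ∈ usedEdges o fs
  path_outer : ∃ x, IsPath src x o x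
  path_face : ∀ f ∈ fs, ∃ x, IsPath src x f x
  euler : (usedEdges o fs).length + 4 ≤
    2 * ((usedEdges o fs).map src).toFinset.card + 2 * (fs.length + 1)
  conjProd : ConjProd (fs.map FreeGroup.mk) (FreeGroup.mk o)

/-- There is a spherical diagram with boundary label `w` and face labels `Rs`. -/
def Bounds {α : Type*} (w : List (α × Bool)) (Rs : List (List (α × Bool))) : Prop :=
  ∃ D : Diagram α, D.o.map D.lab = w ∧ D.fs.map (List.map D.lab) = Rs

theorem usedEdges_perm {o o' : List (ℕ × Bool)} (h : o.Perm o') (fs : List (List (ℕ × Bool))) :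
    (usedEdges o fs).Perm (usedEdges o' fs) := by
  refine List.Perm.append_right _ ?_
  simp only [invRev_eq]
  exact (List.reverse_perm _).trans ((h.map _).trans (List.reverse_perm _).symm)

namespace Bounds

variable {α : Type*} {Rs : List (List (α × Bool))}

theorem rotate {A B : List (α × Bool)} (h : Bounds (A ++ B) Rs) : Bounds (B ++ A) Rs := by
  obtain ⟨⟨o, fs, lab, src, lab_flip, nodup, closed, ⟨x, path⟩, path_face, euler, cp⟩, ho, hf⟩ := h
  obtain ⟨oA, oB, rfl, rfl, rfl⟩ := List.map_eq_append_iff.1 ho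
  have hp : (usedEdges (oB ++ oA) fs).Perm (usedEdges (oA ++ oB) fs) :=
    usedEdges_perm List.perm_append_comm fs
  obtain ⟨z, hz1, hz2⟩ := IsPath.append.1 path
  refine ⟨⟨oB ++ oA, fs, lab, src, lab_flip, hp.nodup_iff.2 nodup, fun d hd => ?_,
    ⟨z, IsPath.append.2 ⟨x, hz2, hz1⟩⟩, path_face, ?_, ?_⟩, by simp, hf⟩
  · exact hp.mem_iff.2 (closed d (hp.mem_iff.1 hd))
  · rw [hp.length_eq, List.toFinset_eq_of_perm _ _ (hp.map src)]
    exact euler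
  · have := cp.conj (FreeGroup.mk oA)⁻¹
    convert this using 1
    simp only [← FreeGroup.mul_mk]
    group

theorem base (c : α × Bool) : Bounds [c, flip c] [] := by
  refine ⟨⟨[(0, true), (0, false)], [], fun d => if d.2 then c else flip c,
    fun d => if d.2 then 0 else 1, ?_, ?_, ?_, ⟨0, ?_⟩, ?_, ?_, ?_⟩, ?_, rfl⟩
  · rintro ⟨d, b⟩
    cases b <;> simp [flip]
  · decide
  · simp [usedEdges, invRev_eq, flip]
  · simp [IsPath, flip]
  · simp
  · decide
  · have : FreeGroup.mk [((0 : ℕ), true), (0, false)] = 1 := mk_cons_flip (0, true) []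
    rw [this]
    exact ConjProd.nil
  · simp

theorem insert_spike {w : List (α × Bool)} (h : Bounds w Rs) (c : α × Bool) :
    Bounds (c :: flip c :: w) Rs := by
  obtain ⟨⟨o, fs, lab, src, lab_flip, nodup, closed, ⟨x, path⟩, path_face, euler, cp⟩, ho, hf⟩ := h
  simp only at ho hf
  obtain ⟨e, he⟩ := Infinite.exists_notMem_finset ((usedEdges o fs).map Prod.fst).toFinset
  obtain ⟨y, hy⟩ := Infinite.exists_notMem_finset ((usedEdges o fs).map src).toFinset
  have he' : ∀ d ∈ usedEdges o fs, d.1 ≠ e := by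
    rintro d hd rfl
    exact he (List.mem_toFinset.2 (List.mem_map_of_mem hd))
  have hu : usedEdges ((e, true) :: (e, false) :: o) fs =
      invRev o ++ (e, true) :: (e, false) :: fs.flatten := by
    simp [usedEdges, invRev_eq, flip]
  have hp : (usedEdges ((e, true) :: (e, false) :: o) fs).Perm
      ((e, true) :: (e, false) :: usedEdges o fs) := by
    rw [hu]
    exact List.perm_middle.trans (List.Perm.cons _ List.perm_middle)
  have ho' : ∀ d ∈ o, d.1 ≠ e := fun d hd =>
    he' (flip d) (List.mem_append_left _ (mem_invRev.2 (by simpa using hd)))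
  have hf' : ∀ f ∈ fs, ∀ d ∈ f, d.1 ≠ e := fun f hf d hd =>
    he' d (List.mem_append_right _ (List.mem_flatten_of_mem hf hd))
  have hpath : ∀ (l : List (ℕ × Bool)) (z : ℕ), (∀ d ∈ l, d.1 ≠ e) → IsPath src z l z →
      IsPath (fun d => if d = (e, true) then x else if d = (e, false) then y else src d) z l z := by
    intro l z hl hz
    have key : ∀ d : ℕ × Bool, d.1 ≠ e →
        (if d = (e, true) then x else if d = (e, false) then y else src d) = src d := by
      intro d hd
      rw [if_neg, if_neg]
      all_goals rintro rfl; exact hd rfl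
    have := hz.map (src' := fun d => if d = (e, true) then x else if d = (e, false) then y else src d)
      id id (by simp) (fun d hd => key d (hl d hd)) (fun d hd => key (flip d) (hl d hd))
    simpa using this
  refine ⟨⟨(e, true) :: (e, false) :: o, fs,
    fun d => if d = (e, true) then c else if d = (e, false) then flip c else lab d,
    fun d => if d = (e, true) then x else if d = (e, false) then y else src d,
    ?_, ?_, ?_, ⟨x, ?_⟩, ?_, ?_, ?_⟩, ?_, ?_⟩
  · rintro ⟨d, b⟩
    by_cases hd : d = e
    · subst hd
      cases b <;> simp [flip]
    · have := lab_flip (d, b)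
      simp only [flip] at this
      simp [flip, hd, this]
  · rw [hp.nodup_iff]
    simp only [List.nodup_cons, List.mem_cons, not_or]
    refine ⟨⟨by simp, fun h => he' _ h rfl⟩, fun h => he' _ h rfl, nodup⟩
  · intro d hd
    rw [hp.mem_iff] at hd ⊢
    simp only [List.mem_cons] at hd ⊢
    rcases hd with rfl | rfl | hd
    · simp [flip]
    · simp [flip]
    · exact Or.inr (Or.inr (closed d hd))
  · refine ⟨by simp, ?_⟩
    simp only [IsPath, flip]
    refine ⟨by simp, ?_⟩
    simpa using hpath o x ho' path
  · intro f hf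
    obtain ⟨z, hz⟩ := path_face f hf
    exact ⟨z, hpath f z (hf' f hf) hz⟩
  · rw [hp.length_eq]
    have : insert y ((usedEdges o fs).map src).toFinset ⊆
        ((usedEdges ((e, true) :: (e, false) :: o) fs).map
        (fun d => if d = (e, true) then x else if d = (e, false) then y else src d)).toFinset := by
      intro z hz
      rw [List.mem_toFinset, List.mem_map]
      rcases Finset.mem_insert.1 hz with rfl | hz
      · exact ⟨(e, false), hp.mem_iff.2 (by simp), by simp⟩
      · rw [List.mem_toFinset, List.mem_map] at hz
        obtain ⟨d, hd, rfl⟩ := hz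
        refine ⟨d, hp.mem_iff.2 (by simp [hd]), ?_⟩
        rw [if_neg, if_neg]
        all_goals rintro rfl; exact he' _ hd rfl
    have := Finset.card_le_card this
    rw [Finset.card_insert_of_notMem hy] at this
    simp only [List.length_cons]
    omega
  · have : FreeGroup.mk ((e, true) :: (e, false) :: o) = FreeGroup.mk o :=
      mk_cons_flip (e, true) o
    rw [this]
    exact cp
  · simp only [List.map_cons, if_true, List.cons.injEq, true_and]
    refine ⟨by simp, ?_⟩
    rw [← ho]
    refine List.map_congr_left fun d hd => ?_
    rw [if_neg, if_neg]
    all_goals rintro rfl; exact ho' _ hd rfl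
  · rw [← hf]
    refine List.map_congr_left fun f hf => List.map_congr_left fun d hd => ?_
    show (if d = (e, true) then c else if d = (e, false) then flip c else lab d) = lab d
    rw [if_neg, if_neg]
    all_goals rintro rfl; exact hf' f hf _ hd rfl

/-- Identifying one vertex with another decreases the number of vertices by at most one. -/
theorem card_identify (s : Finset ℕ) (x y : ℕ) :
    s.card ≤ (s.image fun z => if z = y then x else z).card + 1 := by
  have h : s.erase y ⊆ s.image fun z => if z = y then x else z := by
    intro z hz
    obtain ⟨h1, h2⟩ := Finset.mem_erase.1 hz
    exact Finset.mem_image.2 ⟨z, h2, if_neg h1⟩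
  have h1 := Finset.card_le_card h
  have h2 := Finset.pred_card_le_card_erase (s := s) (a := y)
  omega

theorem split_face {Q w : List (α × Bool)} (h : Bounds (Q ++ w) Rs) :
    Bounds w (invRev Q :: Rs) := by
  obtain ⟨⟨o, fs, lab, src, lab_flip, nodup, closed, ⟨x, path⟩, path_face, euler, cp⟩, ho, hf⟩ := h
  obtain ⟨oQ, o, rfl, rfl, rfl⟩ := List.map_eq_append_iff.1 ho
  obtain ⟨y, hQ, ho⟩ := IsPath.append.1 path
  have hu : usedEdges o (invRev oQ :: fs) = usedEdges (oQ ++ o) fs := by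
    simp [usedEdges, FreeGroup.invRev_append]
  set q : ℕ → ℕ := fun z => if z = y then x else z with hq
  have hqx : q x = x := by simp [hq]
  have hqy : q y = x := by simp [hq]
  have hpath : ∀ {l : List (ℕ × Bool)} {a b : ℕ}, IsPath src a l b →
      IsPath (q ∘ src) (q a) l (q b) := by
    intro l a b hl
    simpa using hl.map (src' := q ∘ src) id q (by simp) (by simp) (by simp)
  refine ⟨⟨o, invRev oQ :: fs, lab, q ∘ src, lab_flip, by rwa [hu], by rwa [hu],
    ⟨x, ?_⟩, ?_, ?_, ?_⟩, rfl, ?_⟩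
  · simpa [hqx, hqy] using hpath ho
  · intro f hf
    rcases List.mem_cons.1 hf with rfl | hf
    · exact ⟨x, by simpa [hqx, hqy] using hpath hQ.invRev⟩
    · obtain ⟨z, hz⟩ := path_face f hf
      exact ⟨_, hpath hz⟩
  · rw [hu]
    have h1 : ((usedEdges (oQ ++ o) fs).map src).toFinset.card ≤
        (((usedEdges (oQ ++ o) fs).map src).toFinset.image q).card + 1 :=
      card_identify ((usedEdges (oQ ++ o) fs).map src).toFinset x y
    have h2 : ((usedEdges (oQ ++ o) fs).map (q ∘ src)).toFinset =
        ((usedEdges (oQ ++ o) fs).map src).toFinset.image q := by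
      rw [← List.map_map]
      ext z
      simp only [List.mem_toFinset, List.mem_map, Finset.mem_image]
    rw [h2]
    simp only [List.length_cons]
    omega
  · have := ConjProd.cons 1 (FreeGroup.mk (invRev oQ)) cp
    convert this using 1
    · rfl
    · rw [← FreeGroup.mul_mk, ← FreeGroup.inv_mk]
      group
  · simp [← hf, map_invRev lab lab_flip]

theorem fold {w : List (α × Bool)} {c : α × Bool} (h : Bounds (c :: flip c :: w) Rs)
    (hw : w ≠ []) : Bounds w Rs := by
  obtain ⟨⟨o, fs, lab, src, lab_flip, nodup, closed, ⟨x, path⟩, path_face, euler, cp⟩, ho, hf⟩ := h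
  simp only at ho hf
  obtain ⟨c1, o, rfl, rfl, ho⟩ := List.map_eq_cons_iff.1 ho
  obtain ⟨c2, o, rfl, hc, rfl⟩ := List.map_eq_cons_iff.1 ho
  obtain ⟨hx1, hx2, hpo⟩ := path
  have hp : (usedEdges (c1 :: c2 :: o) fs).Perm (flip c2 :: flip c1 :: usedEdges o fs) := by
    have : usedEdges (c1 :: c2 :: o) fs = invRev o ++ flip c2 :: flip c1 :: fs.flatten := by
      simp [usedEdges, invRev_eq]
    rw [this]
    exact List.perm_middle.trans (List.Perm.cons _ List.perm_middle)
  have hlen := hp.length_eq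
  simp only [List.length_cons] at hlen
  have hnd := hp.nodup_iff.1 nodup
  simp only [List.nodup_cons, List.mem_cons, not_or] at hnd
  obtain ⟨⟨hne, hn2⟩, hn1, hnd⟩ := hnd
  have hcl : ∀ d ∈ usedEdges o fs, flip d ≠ flip c2 → flip d ≠ flip c1 →
      flip d ∈ usedEdges o fs := by
    intro d hd h2 h1
    have := hp.mem_iff.1 (closed d (hp.mem_iff.2 (by simp [hd])))
    simpa [h1, h2] using this
  by_cases hs : c2 = flip c1
  · subst hs
    simp only [flip_flip] at *
    refine ⟨⟨o, fs, lab, src, lab_flip, hnd, ?_, ⟨src c1, ?_⟩, path_face, ?_, ?_⟩, rfl, hf⟩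
    · intro d hd
      refine hcl d hd ?_ ?_
      · rintro rfl
        exact hn1 (by simpa using hd)
      · intro h
        rw [flip_injective h] at hd
        exact hn2 hd
    · rw [hx1]; exact hx1 ▸ hpo
    · have hx : src c1 ∈ ((usedEdges o fs).map src).toFinset := by
        rcases o with _ | ⟨d, o⟩
        · simp at hw
        have hd : flip d ∈ usedEdges (d :: o) fs :=
          List.mem_append_left _ (mem_invRev.2 (by simp))
        rw [List.mem_toFinset, List.mem_map]
        refine ⟨d, ?_, hpo.1⟩
        have := hcl _ hd ?_ ?_
        · simpa using this
        · rw [flip_flip]; rintro rfl; exact hn1 hd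
        · intro h; rw [flip_injective h] at hd; exact hn2 hd
      have h1 : ((usedEdges (c1 :: flip c1 :: o) fs).map src).toFinset ⊆
          insert (src (flip c1)) ((usedEdges o fs).map src).toFinset := by
        intro z hz
        rw [List.mem_toFinset, List.mem_map] at hz
        obtain ⟨d, hd, rfl⟩ := hz
        rw [hp.mem_iff] at hd
        rcases List.mem_cons.1 hd with rfl | hd
        · exact Finset.mem_insert_of_mem hx
        rcases List.mem_cons.1 hd with rfl | hd
        · exact Finset.mem_insert_self _ _
        · exact Finset.mem_insert_of_mem (List.mem_toFinset.2 (List.mem_map_of_mem hd))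
      have h2 := (Finset.card_le_card h1).trans (Finset.card_insert_le _ _)
      omega
    · rw [mk_cons_flip] at cp
      exact cp
  · have hc21 : c2 ≠ c1 := by
      rintro rfl
      exact flip_ne _ hc.symm
    have hfc : flip c2 ≠ c1 := fun h => hs (by rw [← h, flip_flip])
    have hmem1 : c1 ∈ usedEdges o fs := by
      have := hp.mem_iff.1 (closed (flip c1) (hp.mem_iff.2 (by simp)))
      simpa [hfc.symm, (flip_ne c1).symm] using this
    have hmem2 : c2 ∈ usedEdges o fs := by
      have := hp.mem_iff.1 (closed (flip c2) (hp.mem_iff.2 (by simp)))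
      simpa [hs, (flip_ne c2).symm] using this
    set θ : ℕ × Bool → ℕ × Bool :=
      fun d => if d = c2 then flip c1 else if d = flip c2 then c1 else d with hθ
    have θ2 : θ c2 = flip c1 := by simp [hθ]
    have θ2' : θ (flip c2) = c1 := by simp [hθ, flip_ne]
    have θd : ∀ d, d ≠ c2 → d ≠ flip c2 → θ d = d := fun d h1 h2 => by simp [hθ, h1, h2]
    have θ1 : θ c1 = c1 := θd _ hc21.symm hfc.symm
    have θflip : ∀ d, θ (flip d) = flip (θ d) := by
      intro d
      by_cases h1 : d = c2
      · subst h1; simp [θ2, θ2']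
      by_cases h2 : d = flip c2
      · subst h2; simp [θ2, θ2']
      rw [θd d h1 h2, θd]
      · intro h; exact h2 (by rw [← h, flip_flip])
      · intro h; exact h1 (flip_injective h)
    have θlab : ∀ d, lab (θ d) = lab d := by
      intro d
      by_cases h1 : d = c2
      · subst h1; rw [θ2, lab_flip, hc]
      by_cases h2 : d = flip c2
      · subst h2; rw [θ2', lab_flip, hc, flip_flip]
      rw [θd d h1 h2]
    have hused : usedEdges (o.map θ) (fs.map (List.map θ)) = (usedEdges o fs).map θ := by
      simp [usedEdges, map_invRev θ θflip, List.map_flatten]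
    set q : ℕ → ℕ := fun z => if z = src (flip c2) then src c1 else z with hq
    have q1 : q (src c1) = src c1 := by simp [hq]
    have q2 : q (src (flip c2)) = src c1 := by simp [hq]
    have hsrc : ∀ d, (q ∘ src) (θ d) = q (src d) := by
      intro d
      by_cases h1 : d = c2
      · subst h1; simp [θ2, hx2]
      by_cases h2 : d = flip c2
      · subst h2; simp [θ2', q1, q2]
      rw [θd d h1 h2]; rfl
    have hpath : ∀ {l : List (ℕ × Bool)} {a b : ℕ}, IsPath src a l b →
        IsPath (q ∘ src) (q a) (l.map θ) (q b) := fun hl =>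
      hl.map θ q (fun d _ => θflip d) (fun d _ => hsrc d) (fun d _ => hsrc (flip d))
    refine ⟨⟨o.map θ, fs.map (List.map θ), lab, q ∘ src, lab_flip, ?_, ?_, ⟨src c1, ?_⟩,
      ?_, ?_, ?_⟩, ?_, ?_⟩
    · rw [hused]
      refine hnd.map_on fun d hd e he hde => ?_
      have hd2 : d ≠ flip c2 := fun h => hn2 (h ▸ hd)
      have he2 : e ≠ flip c2 := fun h => hn2 (h ▸ he)
      by_cases h1 : d = c2 <;> by_cases h2 : e = c2
      · rw [h1, h2]
      · rw [h1, θ2, θd e h2 he2] at hde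
        exact absurd (hde ▸ he) hn1
      · rw [h2, θ2, θd d h1 hd2] at hde
        exact absurd (hde ▸ hd) hn1
      · rwa [θd d h1 hd2, θd e h2 he2] at hde
    · rw [hused]
      intro d' hd'
      obtain ⟨d, hd, rfl⟩ := List.mem_map.1 hd'
      rw [← θflip]
      by_cases h2 : d = c2
      · rw [h2, θ2', ← θ1]
        exact List.mem_map_of_mem hmem1
      by_cases h1 : d = c1
      · rw [h1, θflip, θ1, ← θ2]
        exact List.mem_map_of_mem hmem2
      · exact List.mem_map_of_mem (hcl d hd (fun h => h2 (flip_injective h))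
          (fun h => h1 (flip_injective h)))
    · have := hpath hpo
      rwa [← hx1, q1, q2] at this
    · intro f' hf'
      obtain ⟨f, hf, rfl⟩ := List.mem_map.1 hf'
      obtain ⟨z, hz⟩ := path_face f hf
      exact ⟨_, hpath hz⟩
    · rw [hused]
      have h1 : ((usedEdges (c1 :: c2 :: o) fs).map src).toFinset.card ≤
          (((usedEdges (c1 :: c2 :: o) fs).map src).toFinset.image q).card + 1 :=
        card_identify ((usedEdges (c1 :: c2 :: o) fs).map src).toFinset
        (src c1) (src (flip c2))
      have h2 : (((usedEdges (c1 :: c2 :: o) fs).map src).toFinset.image q) ⊆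
          (((usedEdges o fs).map θ).map (q ∘ src)).toFinset := by
        intro z hz
        simp only [Finset.mem_image, List.mem_toFinset, List.mem_map] at hz
        obtain ⟨_, ⟨d, hd, rfl⟩, rfl⟩ := hz
        rw [← hsrc d, List.mem_toFinset]
        refine List.mem_map_of_mem ?_
        rw [hp.mem_iff] at hd
        rcases List.mem_cons.1 hd with rfl | hd
        · rw [θ2', ← θ1]; exact List.mem_map_of_mem hmem1
        rcases List.mem_cons.1 hd with rfl | hd
        · rw [θflip, θ1, ← θ2]; exact List.mem_map_of_mem hmem2
        · exact List.mem_map_of_mem hd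
      have h3 := Finset.card_le_card h2
      simp only [List.length_map] at *
      omega
    · have := cp.map (FreeGroup.lift fun a => FreeGroup.mk [θ (a, true)])
      rw [lift_mk_eq θ θflip, List.map_cons, List.map_cons, θ1, θ2, mk_cons_flip] at this
      convert this using 1
      simp only [List.map_map]
      exact List.map_congr_left fun f _ => (lift_mk_eq θ θflip f).symm
    · simp [θlab]
    · simp [← hf, Function.comp_def, θlab]

theorem insert_spike_middle {A B : List (α × Bool)} (h : Bounds (A ++ B) Rs) (c : α × Bool) :
    Bounds (A ++ c :: flip c :: B) Rs := by
  have h1 : Bounds ((c :: flip c :: B) ++ A) Rs :=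
    h.rotate.insert_spike c
  exact h1.rotate

theorem of_mk_eq_one {w : List (α × Bool)} (hw : w ≠ []) (h : FreeGroup.mk w = 1) :
    Bounds w [] := by
  have hred : FreeGroup.Red w [] := by
    rw [FreeGroup.one_eq_mk, FreeGroup.Red.exact] at h
    obtain ⟨z, hz1, hz2⟩ := h
    rwa [FreeGroup.Red.nil_iff.1 hz2] at hz1
  induction hred using Relation.ReflTransGen.head_induction_on with
  | refl => exact absurd rfl hw
  | head hstep _ ih =>
    rename_i l l'
    cases hstep with
    | not =>
      rename_i A B x b
      by_cases hAB : A ++ B = []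
      · obtain ⟨rfl, rfl⟩ := List.append_eq_nil_iff.1 hAB
        exact base (x, b)
      · refine (ih hAB ?_).insert_spike_middle (x, b)
        rw [← h]
        exact (Quot.sound FreeGroup.Red.Step.not).symm

theorem cancel {g w : List (α × Bool)} (h : Bounds (g ++ invRev g ++ w) Rs) (hw : w ≠ []) :
    Bounds w Rs := by
  induction g using List.reverseRecOn generalizing w with
  | nil => simpa using h
  | append_singleton g c ih =>
    have h1 : g ++ [c] ++ invRev (g ++ [c]) ++ w = g ++ (c :: flip c :: (invRev g ++ w)) := by
      simp [invRev_eq]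
    rw [h1] at h
    have h2 : Bounds (c :: flip c :: (invRev g ++ w ++ g)) Rs := by
      simpa using h.rotate
    have h3 := h2.fold (by simp [hw])
    exact ih (by simpa using h3.rotate) hw

/-- The existence of van Kampen diagrams. -/
theorem of_conjProd [DecidableEq α] {v : List (α × Bool)} (hv : v ≠ [])
    (h : ConjProd (Rs.map FreeGroup.mk) (FreeGroup.mk v)) : Bounds v Rs := by
  induction Rs generalizing v with
  | nil =>
    refine of_mk_eq_one hv ?_
    generalize FreeGroup.mk v = y at h
    cases h
    rfl
  | cons R Rs ih =>
    generalize hy : FreeGroup.mk v = y at h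
    rw [List.map_cons] at h
    cases h with
    | cons g _ h =>
    rename_i y
    obtain ⟨g, rfl⟩ : ∃ g', g = FreeGroup.mk g' := ⟨g.toWord, FreeGroup.mk_toWord.symm⟩
    have h1 : Bounds (g ++ (invRev R ++ (invRev g ++ v))) Rs := by
      refine ih (by simp [hv]) ?_
      convert h using 1
      simp only [← FreeGroup.mul_mk, ← FreeGroup.inv_mk, hy]
      group
    have h2 := h1.rotate
    rw [List.append_assoc] at h2
    have h3 := h2.split_face
    rw [FreeGroup.invRev_invRev] at h3
    have h4 := h3.rotate
    rw [← List.append_assoc] at h4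
    exact h4.cancel hv

end Bounds

/-! ### A combinatorial Gauss–Bonnet formula -/

section GaussBonnet

variable {P : Type*} [Fintype P] [DecidableEq P] {φ α : P → P}

/-- In a combinatorial map with darts `P`, face permutation `φ` and edge involution `α`, with
darts of two types alternating along faces, the vertices other than those of degree two have
degree at least four. -/
theorem four_mul_card_vertices_le (hφ : Function.Injective φ) (hα : Function.Involutive α)
    (ty : P → Fin 2) (htφ : ∀ p, ty (φ p) ≠ ty p) (htα : ∀ p, ty (α p) = ty p)
    (src : P → ℕ) (hsrc : ∀ p, src (φ (α p)) = src p) :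
    4 * (Finset.univ.image src).card
      + (Finset.univ.filter fun p => φ (α (φ (α p))) ≠ p).card ≤ 2 * Fintype.card P := by
  set σ : P → P := fun p => φ (α p) with hσ
  have σinj : Function.Injective σ := hφ.comp hα.injective
  have σty : ∀ p, ty (σ p) ≠ ty p := fun p => by
    rw [← htα p]
    exact htφ (α p)
  have σsrc : ∀ p, src (σ p) = src p := hsrc
  let wt : P → ℕ := fun p => if σ (σ p) ≠ p then 1 else 2
  have hwt : ∀ p, 1 ≤ wt p := fun p => by
    simp only [wt]; split_ifs <;> omega
  have hfib : ∀ x ∈ Finset.univ.image src,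
      4 ≤ ∑ p ∈ Finset.univ.filter (fun p => src p = x), wt p := by
    intro x hx
    obtain ⟨p, -, rfl⟩ := Finset.mem_image.1 hx
    have ne1 : ∀ q, σ q ≠ q := fun q h => σty q (by rw [h])
    by_cases hp : σ (σ p) = p
    · have hsub : ({p, σ p} : Finset P) ⊆ Finset.univ.filter (fun q => src q = src p) := by
        intro q hq
        simp only [Finset.mem_insert, Finset.mem_singleton] at hq
        rcases hq with rfl | rfl <;> simp [σsrc]
      refine le_trans ?_ (Finset.sum_le_sum_of_subset hsub)
      rw [Finset.sum_pair (ne1 p).symm]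
      simp [wt, hp]
    · have ne3 : σ (σ (σ p)) ≠ p := by
        intro h
        have h1 := σty p
        have h2 := σty (σ p)
        have h3 := σty (σ (σ p))
        rw [h] at h3
        omega
      have hsub : ({p, σ p, σ (σ p), σ (σ (σ p))} : Finset P) ⊆
          Finset.univ.filter (fun q => src q = src p) := by
        intro q hq
        simp only [Finset.mem_insert, Finset.mem_singleton] at hq
        rcases hq with rfl | rfl | rfl | rfl <;> simp [σsrc]
      have hcard : ({p, σ p, σ (σ p), σ (σ (σ p))} : Finset P).card = 4 := by
        rw [Finset.card_eq_succ]
        refine ⟨p, {σ p, σ (σ p), σ (σ (σ p))}, ?_, rfl, ?_⟩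
        · simp only [Finset.mem_insert, Finset.mem_singleton, not_or]
          exact ⟨(ne1 p).symm, Ne.symm hp, ne3.symm⟩
        · refine Finset.card_eq_three.2 ⟨_, _, _, (ne1 _).symm, ?_, (ne1 _).symm, rfl⟩
          exact fun h => hp (σinj h).symm
      refine le_trans ?_ (Finset.sum_le_sum_of_subset hsub)
      calc 4 = ∑ q ∈ ({p, σ p, σ (σ p), σ (σ (σ p))} : Finset P), 1 := by simp [hcard]
        _ ≤ _ := Finset.sum_le_sum fun q _ => hwt q
  have h1 : 4 * (Finset.univ.image src).card ≤ ∑ p, wt p := by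
    rw [← Finset.sum_fiberwise_of_maps_to (s := Finset.univ) (t := Finset.univ.image src)
      (g := src) (fun p _ => Finset.mem_image_of_mem _ (Finset.mem_univ p)) wt, mul_comm]
    exact Finset.card_nsmul_le_sum _ _ _ hfib
  have h2 : ∑ p, wt p + (Finset.univ.filter fun p => σ (σ p) ≠ p).card
      = 2 * Fintype.card P := by
    rw [Finset.card_filter, ← Finset.sum_add_distrib, Finset.sum_congr rfl (g := fun _ => 2)]
    · simp [mul_comm]
    · intro p _
      by_cases hp : σ (σ p) = p <;> simp [wt, hp]
  change 4 * _ + (Finset.univ.filter fun p => σ (σ p) ≠ p).card ≤ _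
  omega

/-- In a spherical combinatorial map as in `four_mul_card_vertices_le`, some face other than a
given one has few essential corners. -/
theorem exists_face_few_corners {ι : Type*} [Fintype ι] [DecidableEq ι]
    (hφ : Function.Injective φ) (hα : Function.Involutive α)
    (ty : P → Fin 2) (htφ : ∀ p, ty (φ p) ≠ ty p) (htα : ∀ p, ty (α p) = ty p)
    (src : P → ℕ) (hsrc : ∀ p, src (φ (α p)) = src p)
    (face : P → ι) (hface : ∀ p, face (φ p) = face p) (i₀ : ι)
    (euler : Fintype.card P + 4 ≤ 2 * (Finset.univ.image src).card + 2 * Fintype.card ι) :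
    ∃ k ≠ i₀,
      (Finset.univ.filter fun p => (φ (α (φ (α p))) ≠ p ∧ face (α p) = i₀) ∧ face p = k).card +
      (Finset.univ.filter fun p => φ (α (φ (α p))) ≠ p ∧ face p = k).card ≤ 3 := by
  by_contra! hcon
  have hV := four_mul_card_vertices_le hφ hα ty htφ htα src hsrc
  have hfib : ∀ s : P → Prop, [DecidablePred s] →
      ∑ k, (Finset.univ.filter fun p => s p ∧ face p = k).card
        = (Finset.univ.filter s).card := by
    intro s _
    rw [Finset.card_eq_sum_card_fiberwise (f := face) (t := Finset.univ) (fun _ _ => by simp)]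
    simp [Finset.filter_filter]
  have h1 := hfib fun p => φ (α (φ (α p))) ≠ p
  have h2 := hfib fun p => φ (α (φ (α p))) ≠ p ∧ face (α p) = i₀
  rw [← Finset.add_sum_erase _ _ (Finset.mem_univ i₀)] at h1 h2
  have h3 : ∑ k ∈ Finset.univ.erase i₀, 4 ≤ ∑ k ∈ Finset.univ.erase i₀,
      ((Finset.univ.filter fun p => (φ (α (φ (α p))) ≠ p ∧ face (α p) = i₀) ∧ face p = k).card +
      (Finset.univ.filter fun p => φ (α (φ (α p))) ≠ p ∧ face p = k).card) :=
    Finset.sum_le_sum fun k hk => hcon k (Finset.ne_of_mem_erase hk)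
  rw [Finset.sum_add_distrib, Finset.sum_const, Finset.card_erase_of_mem (Finset.mem_univ _),
    Finset.card_univ, smul_eq_mul] at h3
  have h4 : (Finset.univ.filter fun p => φ (α (φ (α p))) ≠ p ∧ face (α p) = i₀).card ≤
      (Finset.univ.filter fun p => φ (α (φ (α p))) ≠ p ∧ face p = i₀).card := by
    refine Finset.card_le_card_of_injOn (fun p => φ (α p)) ?_
      (fun p _ q _ h => hα.injective (hφ h))
    intro p hp
    simp only [Finset.coe_filter, Finset.mem_univ, true_and, Set.mem_ofPred_eq] at hp ⊢
    refine ⟨fun h => hp.1 (hα.injective (hφ h)), by rw [hface, hp.2]⟩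
  have h5 : 0 < Fintype.card ι := Fintype.card_pos_iff.2 ⟨i₀⟩
  omega

end GaussBonnet

/-! ### Polygons glued to a sphere -/

/-- Polygons indexed by `ι` whose sides (darts) `P` are glued in pairs by an involution, such
that the Euler characteristic is at least two. -/
structure Gluing (ι P : Type*) [Fintype ι] [Fintype P] [DecidableEq P] where
  /-- the number of sides of a polygon -/
  len : ι → ℕ
  /-- the sides of a polygon, in cyclic order -/
  dart : ι → ℤ → P
  /-- the gluing -/
  inv : P → P
  /-- the initial vertex of a side -/
  src : P → ℕ
  dart_eq_iff : ∀ k g s t, dart k s = dart g t ↔ k = g ∧ (len k : ℤ) ∣ t - s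
  exists_dart : ∀ p, ∃ k t, dart k t = p
  inv_inv : ∀ p, inv (inv p) = p
  src_next : ∀ k t, src (dart k (t + 1)) = src (inv (dart k t))
  euler : Fintype.card P + 4 ≤ 2 * (Finset.univ.image src).card + 2 * Fintype.card ι

namespace Gluing

variable {ι P : Type*} [Fintype ι] [Fintype P] [DecidableEq P] (G : Gluing ι P)

/-- The polygon containing a dart. -/
noncomputable def face (p : P) : ι := (G.exists_dart p).choose

/-- The position of a dart in its polygon. -/
noncomputable def idx (p : P) : ℤ := (G.exists_dart p).choose_spec.choose

theorem dart_face_idx (p : P) : G.dart (G.face p) (G.idx p) = p :=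
  (G.exists_dart p).choose_spec.choose_spec

@[simp] theorem face_dart (k : ι) (t : ℤ) : G.face (G.dart k t) = k :=
  ((G.dart_eq_iff _ _ _ _).1 (G.dart_face_idx (G.dart k t))).1

/-- The next dart on the boundary of a polygon. -/
noncomputable def next (p : P) : P := G.dart (G.face p) (G.idx p + 1)

@[simp] theorem next_dart (k : ι) (t : ℤ) : G.next (G.dart k t) = G.dart k (t + 1) := by
  have h := G.dart_face_idx (G.dart k t)
  rw [G.dart_eq_iff] at h
  rw [next, G.dart_eq_iff]
  exact ⟨h.1, by simpa using h.2⟩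

@[simp] theorem face_next (p : P) : G.face (G.next p) = G.face p := by
  obtain ⟨k, t, rfl⟩ := G.exists_dart p
  simp

theorem next_injective : Function.Injective G.next := by
  intro p q h
  obtain ⟨k, s, rfl⟩ := G.exists_dart p
  obtain ⟨g, t, rfl⟩ := G.exists_dart q
  rw [next_dart, next_dart, G.dart_eq_iff] at h
  rw [G.dart_eq_iff]
  exact ⟨h.1, by simpa using h.2⟩

theorem src_next_inv (p : P) : G.src (G.next (G.inv p)) = G.src p := by
  obtain ⟨k, t, h⟩ := G.exists_dart (G.inv p)
  rw [← h, next_dart, G.src_next, h, G.inv_inv]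

/-- A dart is essential if its initial vertex does not have degree two. -/
def Essential (p : P) : Prop := G.next (G.inv (G.next (G.inv p))) ≠ p

theorem next_inv_of_not_essential {k : ι} {t : ℤ} (h : ¬ G.Essential (G.dart k (t + 1))) :
    G.next (G.inv (G.dart k (t + 1))) = G.inv (G.dart k t) := by
  rw [Essential, not_not] at h
  nth_rewrite 2 [← next_dart] at h
  rw [← G.next_injective h, G.inv_inv]

/-- The part of the boundary of a polygon without essential corners is glued to a single
polygon. -/
theorem inv_dart_of_not_essential {k g : ι} {x y : ℤ} {T : ℕ}
    (h : ∀ t, x < t → t ≤ x + T → ¬ G.Essential (G.dart k t))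
    (hy : G.inv (G.dart k (x + T)) = G.dart g y) (s : ℕ) (hs : s ≤ T) :
    G.inv (G.dart k (x + T - s)) = G.dart g (y + s) := by
  induction s with
  | zero => simpa using hy
  | succ s ih =>
    have h1 := G.next_inv_of_not_essential (k := k) (t := x + T - (s + 1 : ℕ))
      (h _ (by push_cast; omega) (by push_cast; omega))
    rw [← h1, show x + T - ((s + 1 : ℕ) : ℤ) + 1 = x + T - s by push_cast; ring, ih (by omega),
      next_dart]
    push_cast
    ring_nf

theorem dart_add_mul (k : ι) (t K : ℤ) : G.dart k (t + G.len k * K) = G.dart k t := by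
  rw [G.dart_eq_iff]
  exact ⟨rfl, ⟨-K, by ring⟩⟩

/-- A property of the darts of a polygon which is neither always nor never satisfied starts at
some corner. -/
theorem exists_essential {k : ι} (hk : 0 < G.len k) {Q : P → Prop}
    (hQ : ∀ t, ¬ G.Essential (G.dart k t) → Q (G.dart k t) → Q (G.dart k (t - 1)))
    {t₀ t₁ : ℤ} (h₀ : Q (G.dart k t₀)) (h₁ : ¬ Q (G.dart k t₁)) :
    ∃ t, G.Essential (G.dart k t) ∧ Q (G.dart k t) := by
  by_contra! hcon
  have key : ∀ n : ℕ, Q (G.dart k (t₀ - n)) := by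
    intro n
    induction n with
    | zero => simpa using h₀
    | succ n ih =>
      have := hQ _ (fun h => hcon _ h ih) ih
      rwa [show t₀ - ((n + 1 : ℕ) : ℤ) = t₀ - n - 1 by push_cast; ring]
  refine h₁ ?_
  have h2 : 0 ≤ t₀ - t₁ + G.len k * |t₀ - t₁| := by
    have h3 := neg_abs_le (t₀ - t₁)
    have h4 : (1 : ℤ) * |t₀ - t₁| ≤ G.len k * |t₀ - t₁| :=
      mul_le_mul_of_nonneg_right (by exact_mod_cast hk) (abs_nonneg _)
    omega
  have := key (t₀ - t₁ + G.len k * |t₀ - t₁|).toNat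
  rw [Int.toNat_of_nonneg h2] at this
  rw [← G.dart_add_mul k t₁ (-|t₀ - t₁|)]
  convert this using 2
  ring

end Gluing

namespace Gluing

variable {ι P : Type*} [Fintype ι] [Fintype P] [DecidableEq P] (G : Gluing ι P)

/-- If a polygon meets the polygon `i₀` in a segment, and the complementary segment is glued to a
single other polygon, then, if the latter does not contain marked darts of all types, the former
contains a long segment starting with a marked dart. -/
theorem exists_segment {i₀ k : ι} {p N : ℕ} (hlen : G.len k = N * p) (hN : 0 < N)
    {mark : Fin 2 → ℤ → Prop}
    (hmark : ∀ τ (x : ℤ), ∃ i, x ≤ i ∧ i < x + p ∧ mark τ i)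
    (hper : ∀ τ (i : ℤ), mark τ i → mark τ (i + p))
    (H : ∀ g ≠ i₀, ∀ (x y : ℤ) (T : ℕ),
      (∀ s ≤ T, G.inv (G.dart k (x + T - s)) = G.dart g (y + s)) →
        ¬ ∀ τ, ∃ i, x ≤ i ∧ i ≤ x + T ∧ mark τ i)
    {x : ℤ} {t : ℕ} (ht : 0 < t) (htL : t ≤ G.len k)
    (h₁ : ∀ z, x < z → z < x + t → ¬ G.Essential (G.dart k z))
    (h₂ : ∀ z, x + t < z → z < x + G.len k → ¬ G.Essential (G.dart k z))
    (hx : G.face (G.inv (G.dart k x)) = i₀)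
    (hxt : t < G.len k → G.face (G.inv (G.dart k (x + t))) ≠ i₀) :
    ∃ τ X y, mark τ X ∧ ∀ s ≤ (N - 1) * p,
      G.inv (G.dart k (X + ((N - 1) * p : ℕ) - s)) = G.dart i₀ (y + s) := by
  obtain ⟨τ, hτ⟩ : ∃ τ, ∀ i, x + t ≤ i → i < x + G.len k → ¬ mark τ i := by
    rcases htL.lt_or_eq with htL | htL
    · obtain ⟨g, y, hy⟩ := G.exists_dart (G.inv (G.dart k (x + t + (G.len k - t - 1 : ℕ))))
      have hrun := G.inv_dart_of_not_essential (x := x + t) (T := G.len k - t - 1)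
        (fun z h3 h4 => h₂ z h3 (by omega)) hy.symm
      have hg : g ≠ i₀ := by
        have := hrun _ le_rfl
        rintro rfl
        apply hxt htL
        rw [show x + t + ((G.len k - t - 1 : ℕ) : ℤ) - (G.len k - t - 1 : ℕ) = x + t by ring]
          at this
        rw [this, face_dart]
      have := H g hg _ _ _ hrun
      push Not at this
      obtain ⟨τ, hτ⟩ := this
      exact ⟨τ, fun i hi1 hi2 => hτ i hi1 (by omega)⟩
    · exact ⟨0, fun i hi1 hi2 => by omega⟩
  obtain ⟨X, hX1, hX2, hX3⟩ := hmark τ x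
  have hX4 : ∀ n : ℕ, mark τ (X + n * p) := by
    intro n
    induction n with
    | zero => simpa using hX3
    | succ n ih =>
      have := hper _ _ ih
      convert this using 1
      push_cast
      ring
  have hNp : (N - 1) * p + p = N * p := by
    obtain ⟨N, rfl⟩ := Nat.exists_eq_succ_of_ne_zero hN.ne'
    simp [Nat.succ_mul]
  have hX5 : X + ((N - 1) * p : ℕ) < x + t := by
    by_contra hcon
    refine hτ _ (not_lt.1 hcon) (by omega) ?_
    rw [Nat.cast_mul]
    exact hX4 (N - 1)
  obtain ⟨g, y, hy⟩ := G.exists_dart (G.inv (G.dart k (x + (t - 1 : ℕ))))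
  have hrun := G.inv_dart_of_not_essential (x := x) (T := t - 1)
    (fun z h3 h4 => h₁ z h3 (by omega)) hy.symm
  have hg : g = i₀ := by
    have := hrun _ le_rfl
    rw [show x + ((t - 1 : ℕ) : ℤ) - (t - 1 : ℕ) = x by ring] at this
    rw [← hx, this, face_dart]
  subst hg
  obtain ⟨d, hd⟩ : ∃ d : ℕ, x + ((t - 1 : ℕ) : ℤ) - d = X + ((N - 1) * p : ℕ) :=
    ⟨(x + ((t - 1 : ℕ) : ℤ) - (X + ((N - 1) * p : ℕ))).toNat, by omega⟩
  refine ⟨τ, X, y + d, hX3, fun s hs => ?_⟩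
  have := hrun (d + s) (by omega)
  rw [← hd]
  rw [show x + ((t - 1 : ℕ) : ℤ) - d - s = x + (t - 1 : ℕ) - (d + s : ℕ) by push_cast; ring, this]
  push_cast
  ring_nf

/-- The main geometric step: with alternating types of darts, and if no segment of a polygon
glued to a polygon other than `i₀` contains marked darts of both types, then some polygon is
glued to `i₀` along a long segment starting with a marked dart. -/
theorem exists_long_segment [DecidableEq ι] (i₀ : ι) (ty : P → Fin 2)
    (hty : ∀ p, ty (G.next p) ≠ ty p) (htyinv : ∀ p, ty (G.inv p) = ty p)
    {p N : ℕ} (hp : 0 < p) (hN : 4 ≤ N) (hlen : ∀ k ≠ i₀, G.len k = N * p)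
    (mark : ι → Fin 2 → ℤ → Prop)
    (hmark : ∀ k ≠ i₀, ∀ τ (x : ℤ), ∃ i, x ≤ i ∧ i < x + p ∧ mark k τ i)
    (hper : ∀ k ≠ i₀, ∀ τ (i : ℤ), mark k τ i → mark k τ (i + p))
    (H : ∀ k ≠ i₀, ∀ g ≠ i₀, ∀ (x y : ℤ) (T : ℕ),
      (∀ s ≤ T, G.inv (G.dart k (x + T - s)) = G.dart g (y + s)) →
        ¬ ∀ τ, ∃ i, x ≤ i ∧ i ≤ x + T ∧ mark k τ i) :
    ∃ k ≠ i₀, ∃ τ X y, mark k τ X ∧ ∀ s ≤ (N - 1) * p,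
      G.inv (G.dart k (X + ((N - 1) * p : ℕ) - s)) = G.dart i₀ (y + s) := by
  classical
  obtain ⟨k, hk, hcard⟩ := exists_face_few_corners G.next_injective G.inv_inv ty hty htyinv G.src
    G.src_next_inv G.face G.face_next i₀ G.euler
  refine ⟨k, hk, ?_⟩
  have hL := hlen k hk
  have hLpos : 0 < G.len k := by rw [hL]; positivity
  set J := Finset.univ.filter fun p =>
    (G.next (G.inv (G.next (G.inv p))) ≠ p ∧ G.face (G.inv p) = i₀) ∧ G.face p = k with hJ
  set E := Finset.univ.filter fun p => G.next (G.inv (G.next (G.inv p))) ≠ p ∧ G.face p = k with hE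
  have hJE : J ⊆ E := fun q hq => by
    simp only [hJ, hE, Finset.mem_filter, Finset.mem_univ, true_and] at hq ⊢
    exact ⟨hq.1.1, hq.2⟩
  have memE : ∀ {t}, G.Essential (G.dart k t) → G.dart k t ∈ E := fun {t} h =>
    Finset.mem_filter.2 ⟨Finset.mem_univ _, h, by simp⟩
  have memJ : ∀ {t}, G.Essential (G.dart k t) → G.face (G.inv (G.dart k t)) = i₀ →
      G.dart k t ∈ J := fun {t} h h' =>
    Finset.mem_filter.2 ⟨Finset.mem_univ _, ⟨h, h'⟩, by simp⟩
  have hout : ∀ t, ¬ G.Essential (G.dart k t) →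
      G.face (G.inv (G.dart k t)) = G.face (G.inv (G.dart k (t - 1))) := by
    intro t ht
    have := G.next_inv_of_not_essential (k := k) (t := t - 1) (by simpa using ht)
    rw [← this, face_next, sub_add_cancel]
  have hseg := fun x t => G.exists_segment (i₀ := i₀) (x := x) (t := t) hL (by omega) (hmark k hk)
    (hper k hk) (H k hk)
  have hinj : ∀ {s t : ℤ}, |t - s| < G.len k → G.dart k s = G.dart k t → s = t := by
    intro s t hst h
    have h1 := ((G.dart_eq_iff _ _ _ _).1 h).2
    have := Int.eq_zero_of_abs_lt_dvd h1 hst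
    omega
  have hEJ : ∀ {t}, G.Essential (G.dart k t) → G.face (G.inv (G.dart k t)) ≠ i₀ →
      G.dart k t ∈ E \ J := fun {t} h h' =>
    Finset.mem_sdiff.2 ⟨memE h, fun hh => h' (Finset.mem_filter.1 hh).2.1.2⟩
  have hsd := Finset.card_sdiff_add_card_eq_card hJE
  by_cases h₀ : ∃ t, G.face (G.inv (G.dart k t)) = i₀
  · obtain ⟨t₀, h₀⟩ := h₀
    by_cases h₁ : ∃ t, G.face (G.inv (G.dart k t)) ≠ i₀
    · obtain ⟨t₁, h₁⟩ := h₁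
      obtain ⟨x, hx, hxo⟩ := G.exists_essential hLpos (Q := fun q => G.face (G.inv q) = i₀)
        (fun t ht h => (hout t ht).symm.trans h) h₀ h₁
      obtain ⟨x', hx', hxo'⟩ := G.exists_essential hLpos (Q := fun q => G.face (G.inv q) ≠ i₀)
        (fun t ht h => (hout t ht) ▸ h) h₁ (by simpa using h₀)
      have hxJ := memJ hx hxo
      have hxE := hEJ hx' hxo'
      have c1 : 0 < J.card := Finset.card_pos.2 ⟨_, hxJ⟩
      have c2 : 0 < (E \ J).card := Finset.card_pos.2 ⟨_, hxE⟩
      have hJ1 : J.card = 1 := by omega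
      have hE1 : (E \ J).card = 1 := by omega
      have huniq : ∀ z, G.Essential (G.dart k z) → G.dart k z = G.dart k x ∨
          G.dart k z = G.dart k x' := by
        intro z hz
        by_cases hzo : G.face (G.inv (G.dart k z)) = i₀
        · exact Or.inl (Finset.card_le_one.1 hJ1.le _ (memJ hz hzo) _ hxJ)
        · exact Or.inr (Finset.card_le_one.1 hE1.le _ (hEJ hz hzo) _ hxE)
      set t := ((x' - x) % G.len k).toNat with ht
      have hLz : (0 : ℤ) < G.len k := by exact_mod_cast hLpos
      have ht' : (t : ℤ) = (x' - x) % G.len k :=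
        Int.toNat_of_nonneg (Int.emod_nonneg _ hLz.ne')
      have htlt : (t : ℤ) < G.len k := ht' ▸ Int.emod_lt_of_pos _ hLz
      have hxt : G.dart k (x + t) = G.dart k x' := by
        rw [G.dart_eq_iff]
        refine ⟨rfl, (x' - x) / G.len k, ?_⟩
        rw [ht']
        have := Int.emod_add_mul_ediv (x' - x) (G.len k)
        linarith
      have ht0 : 0 < t := by
        rcases Nat.eq_zero_or_pos t with h | h
        · rw [h] at hxt
          refine absurd hxo ?_
          have : G.dart k x = G.dart k x' := by simpa using hxt
          rwa [this]
        · exact h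
      refine hseg x t ht0 (by exact_mod_cast htlt.le) ?_ ?_ hxo (fun _ => by rwa [hxt])
      · intro z hz1 hz2 hz
        rcases huniq z hz with h | h
        · have := hinj (abs_lt.2 ⟨by omega, by omega⟩) h
          omega
        · have := hinj (abs_lt.2 ⟨by omega, by omega⟩) (h.trans hxt.symm)
          omega
      · intro z hz1 hz2 hz
        rcases huniq z hz with h | h
        · have := hinj (abs_lt.2 ⟨by omega, by omega⟩) h
          omega
        · have := hinj (abs_lt.2 ⟨by omega, by omega⟩) (h.trans hxt.symm)
          omega
    · push Not at h₁
      have hE0 : E.card ≤ 1 := by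
        have : E ⊆ J := fun q hq => by
          simp only [hJ, hE, Finset.mem_filter, Finset.mem_univ, true_and] at hq ⊢
          refine ⟨⟨hq.1, ?_⟩, hq.2⟩
          have := h₁ (G.idx q)
          rwa [← hq.2, dart_face_idx] at this
        have := Finset.card_le_card this
        omega
      obtain ⟨x, hx⟩ : ∃ x, ∀ z, G.Essential (G.dart k z) → G.dart k z = G.dart k x := by
        by_cases he : ∃ x, G.Essential (G.dart k x)
        · obtain ⟨x, hx⟩ := he
          exact ⟨x, fun z hz => Finset.card_le_one.1 hE0 _ (memE hz) _ (memE hx)⟩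
        · exact ⟨0, fun z hz => absurd ⟨z, hz⟩ he⟩
      refine hseg x (G.len k) hLpos le_rfl ?_ ?_ (h₁ x) (fun h => absurd h (lt_irrefl _))
      · intro z hz1 hz2 hz
        have := hinj (abs_lt.2 ⟨by omega, by omega⟩) (hx z hz)
        omega
      · intro z hz1 hz2
        omega
  · exfalso
    push Not at h₀
    have hpN : 4 * p ≤ G.len k := by rw [hL]; gcongr
    obtain ⟨b, hb⟩ : ∃ b : Fin 4, ∀ z : ℤ, (b : ℕ) * (p : ℤ) ≤ z → z < (b : ℕ) * (p : ℤ) + p →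
        ¬ G.Essential (G.dart k z) := by
      by_contra! hcon
      choose z hz1 hz2 hz3 using hcon
      have hbound : ∀ b, 0 ≤ z b ∧ z b < 4 * p := by
        intro b
        have h1 := hz1 b
        have h2 := hz2 b
        have h3 : ((b : ℕ) : ℤ) * p ≤ 3 * p :=
          mul_le_mul_of_nonneg_right (by omega) (Int.natCast_nonneg p)
        have h4 : 0 ≤ ((b : ℕ) : ℤ) * p := by positivity
        omega
      have h4 : (Finset.univ : Finset (Fin 4)).card ≤ E.card := by
        refine Finset.card_le_card_of_injOn (fun b => G.dart k (z b)) (fun b _ => memE (hz3 b)) ?_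
        intro b _ c _ hbc
        have h1 := hbound b
        have h2 := hbound c
        have h3 := hinj (abs_lt.2 ⟨by omega, by omega⟩) hbc
        have h4 := hz1 b
        have h5 := hz2 b
        have h6 := hz1 c
        have h7 := hz2 c
        rw [← h3] at h6 h7
        have h8 : ((b : ℕ) : ℤ) < (c : ℕ) + 1 :=
          lt_of_mul_lt_mul_right (by linarith) (Int.natCast_nonneg p)
        have h9 : ((c : ℕ) : ℤ) < (b : ℕ) + 1 :=
          lt_of_mul_lt_mul_right (by linarith) (Int.natCast_nonneg p)
        exact Fin.ext (by omega)
      simp at h4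
      omega
    obtain ⟨g, y, hy⟩ := G.exists_dart (G.inv (G.dart k ((b : ℕ) * (p : ℤ) + (p - 1 : ℕ))))
    have hrun := G.inv_dart_of_not_essential (fun z h3 h4 => hb z h3.le (by omega)) hy.symm
    have hg : g ≠ i₀ := by
      rintro rfl
      exact h₀ _ (by rw [← hy, face_dart])
    refine H k hk g hg _ _ _ hrun fun τ => ?_
    obtain ⟨i, hi1, hi2, hi3⟩ := hmark k hk τ ((b : ℕ) * (p : ℤ))
    exact ⟨i, hi1, by omega, hi3⟩

end Gluing

/-! ### Cyclic words -/

/-- The letters of a nonempty cyclic word, indexed by the integers. -/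
def cyc {A : Type*} (l : List A) (hl : l ≠ []) (t : ℤ) : A :=
  l[(t % l.length).toNat]'(by
    have h : (0 : ℤ) < l.length := by exact_mod_cast List.length_pos_iff.2 hl
    have := Int.emod_nonneg t h.ne'
    have := Int.emod_lt_of_pos t h
    omega)

section cyc

variable {A B : Type*} {l : List A}

theorem cyc_natCast (hl : l ≠ []) {i : ℕ} (hi : i < l.length) : cyc l hl i = l[i] := by
  have : (((i : ℕ) : ℤ) % l.length).toNat = i := by
    rw [Int.emod_eq_of_lt (by omega) (by exact_mod_cast hi), Int.toNat_natCast]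
  simp only [cyc, this]

theorem cyc_mem (hl : l ≠ []) (t : ℤ) : cyc l hl t ∈ l := List.getElem_mem _

theorem exists_cyc_eq (hl : l ≠ []) {a : A} (ha : a ∈ l) : ∃ t, cyc l hl t = a := by
  obtain ⟨i, hi, rfl⟩ := List.mem_iff_getElem.1 ha
  exact ⟨i, cyc_natCast hl hi⟩

theorem cyc_congr (hl : l ≠ []) {s t : ℤ} (h : (l.length : ℤ) ∣ t - s) :
    cyc l hl s = cyc l hl t := by
  have : s % l.length = t % l.length := (Int.modEq_iff_dvd.2 h)
  simp only [cyc, this]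

theorem exists_nat_modEq (hl : l ≠ []) (t : ℤ) : ∃ i : ℕ, i < l.length ∧ (l.length : ℤ) ∣ t - i := by
  have h : (0 : ℤ) < l.length := by exact_mod_cast List.length_pos_iff.2 hl
  have h1 := Int.emod_nonneg t h.ne'
  have h2 := Int.emod_lt_of_pos t h
  refine ⟨(t % l.length).toNat, by omega, ?_⟩
  rw [Int.toNat_of_nonneg h1]
  exact Int.dvd_self_sub_emod

/-- It suffices to check a property of the letters of a cyclic word on its indices. -/
theorem cyc_eq_getElem (hl : l ≠ []) (t : ℤ) :
    ∃ i : ℕ, ∃ hi : i < l.length, (l.length : ℤ) ∣ t - i ∧ cyc l hl t = l[i] := by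
  obtain ⟨i, hi, h⟩ := exists_nat_modEq hl t
  exact ⟨i, hi, h, by rw [← cyc_natCast hl hi, cyc_congr hl h]⟩

theorem cyc_eq_iff (hl : l ≠ []) (hnd : l.Nodup) (s t : ℤ) :
    cyc l hl s = cyc l hl t ↔ (l.length : ℤ) ∣ t - s := by
  refine ⟨fun h => ?_, cyc_congr hl⟩
  obtain ⟨i, hi, hsi, h1⟩ := cyc_eq_getElem hl s
  obtain ⟨j, hj, htj, h2⟩ := cyc_eq_getElem hl t
  rw [h1, h2, hnd.getElem_inj_iff] at h
  subst h
  simpa using dvd_sub htj hsi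

theorem map_cyc (f : A → B) (hl : l ≠ []) (t : ℤ) :
    f (cyc l hl t) = cyc (l.map f) (by simpa using hl) t := by
  simp [cyc]

theorem cyc_invRev {l : List (A × Bool)} (hl : l ≠ []) (hl' : invRev l ≠ []) (t : ℤ) :
    cyc (invRev l) hl' t = flip (cyc l hl (-1 - t)) := by
  obtain ⟨i, hi, hti, h⟩ := cyc_eq_getElem hl' t
  rw [h]
  rw [FreeGroup.invRev_length] at hi hti
  have h1 : cyc l hl (-1 - t) = cyc l hl ((l.length - 1 - i : ℕ) : ℤ) := by
    refine cyc_congr hl ?_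
    have h2 : ((l.length - 1 - i : ℕ) : ℤ) - (-1 - t) = l.length + (t - i) := by omega
    rw [h2]
    exact dvd_add dvd_rfl hti
  rw [h1, cyc_natCast hl (by omega)]
  simp [invRev_eq]

theorem IsPath.cyc_succ {α : Type*} {src : α × Bool → ℕ} {l : List (α × Bool)} {x : ℕ}
    (h : IsPath src x l x) (hl : l ≠ []) (t : ℤ) :
    src (cyc l hl (t + 1)) = src (flip (cyc l hl t)) := by
  obtain ⟨i, hi, hti, h1⟩ := cyc_eq_getElem hl t
  rw [h1]
  by_cases hi' : i + 1 < l.length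
  · rw [← h.getElem i hi', ← cyc_natCast hl hi']
    congr 1
    refine cyc_congr hl ?_
    rw [show ((i + 1 : ℕ) : ℤ) - (t + 1) = -(t - i) by push_cast; ring]
    exact dvd_neg.2 hti
  · obtain ⟨h2, h3⟩ := h.getElem_last (List.length_pos_iff.2 hl)
    have h4 : cyc l hl (t + 1) = cyc l hl ((0 : ℕ) : ℤ) := by
      refine cyc_congr hl ?_
      rw [show ((0 : ℕ) : ℤ) - (t + 1) = -((t - i) + l.length) by omega]
      exact dvd_neg.2 (dvd_add hti dvd_rfl)
    rw [h4, cyc_natCast hl (List.length_pos_iff.2 hl), h2]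
    have : i = l.length - 1 := by omega
    simp only [this, h3]

/-- Windows of cyclic words are prefixes of rotations. -/
theorem map_cyc_prefix (hl : l ≠ []) (x : ℤ) {T : ℕ} (hT : T ≤ l.length) :
    ∃ k, (List.range T).map (fun s : ℕ => cyc l hl (x + s)) <+: l.rotate k := by
  obtain ⟨k, hk, hxk⟩ := exists_nat_modEq hl x
  refine ⟨k, ?_⟩
  have : (List.range T).map (fun s : ℕ => cyc l hl (x + s)) = (l.rotate k).take T := by
    refine List.ext_getElem (by simpa using hT) fun i h1 h2 => ?_
    simp only [List.getElem_map, List.getElem_range, List.getElem_take, List.getElem_rotate]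
    rw [← cyc_natCast hl]
    refine cyc_congr hl ?_
    push_cast
    have h3 := dvd_add (Int.dvd_self_sub_emod (x := (i + k : ℤ)) (m := l.length)) hxk
    rw [show (i + k : ℤ) % l.length - (x + i) = -((i + k : ℤ) - (i + k : ℤ) % l.length + (x - k)) by
      ring]
    exact dvd_neg.2 h3
  rw [this]
  exact List.take_prefix _ _

end cyc

/-! ### The gluing of a diagram -/

namespace Diagram

variable {α : Type*} (D : Diagram α)

/-- The boundaries of all faces, the outer face being the first one. -/
def faces : List (List (ℕ × Bool)) := invRev D.o :: D.fs

theorem flatten_faces : D.faces.flatten = usedEdges D.o D.fs := rfl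

theorem cyc_mem_used (hne : ∀ f ∈ D.faces, f ≠ []) (k : Fin D.faces.length) (t : ℤ) :
    cyc (D.faces.get k) (hne _ (List.get_mem _ _)) t ∈ (usedEdges D.o D.fs).toFinset := by
  rw [List.mem_toFinset, ← flatten_faces]
  exact List.mem_flatten_of_mem (List.get_mem _ _) (cyc_mem _ _)

/-- The gluing of polygons underlying a diagram. -/
def gluing (hne : ∀ f ∈ D.faces, f ≠ []) :
    Gluing (Fin D.faces.length) {d // d ∈ (usedEdges D.o D.fs).toFinset} where
  len k := (D.faces.get k).length
  dart k t := ⟨cyc (D.faces.get k) (hne _ (List.get_mem _ _)) t, D.cyc_mem_used hne k t⟩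
  inv p := ⟨flip p.1, List.mem_toFinset.2 (D.closed _ (List.mem_toFinset.1 p.2))⟩
  src p := D.src p.1
  dart_eq_iff k g s t := by
    have hnd := D.nodup
    rw [← flatten_faces, List.nodup_flatten] at hnd
    rw [Subtype.mk.injEq]
    have hdisj : ∀ k g : Fin D.faces.length, k < g → ∀ d ∈ D.faces.get k, d ∉ D.faces.get g :=
      fun k g hkg d hd hd' =>
        List.pairwise_iff_getElem.1 hnd.2 k g k.2 g.2 hkg hd hd'
    constructor
    · intro h
      have h1 := cyc_mem (hne _ (List.get_mem _ k)) s
      have h2 := cyc_mem (hne _ (List.get_mem _ g)) t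
      rw [← h] at h2
      obtain rfl : k = g := by
        rcases lt_trichotomy k g with hkg | hkg | hkg
        · exact absurd h2 (hdisj _ _ hkg _ h1)
        · exact hkg
        · exact absurd h1 (hdisj _ _ hkg _ h2)
      exact ⟨rfl, (cyc_eq_iff _ (hnd.1 _ (List.get_mem _ k)) _ _).1 h⟩
    · rintro ⟨rfl, h⟩
      exact cyc_congr _ h
  exists_dart := by
    rintro ⟨d, hd⟩
    have hd' := hd
    rw [List.mem_toFinset, ← flatten_faces, List.mem_flatten] at hd'
    obtain ⟨f, hf, hdf⟩ := hd'
    obtain ⟨k, rfl⟩ := List.get_of_mem hf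
    obtain ⟨t, ht⟩ := exists_cyc_eq (hne _ (List.get_mem _ k)) hdf
    exact ⟨k, t, Subtype.ext ht⟩
  inv_inv p := Subtype.ext (flip_flip _)
  src_next k t := by
    have : ∃ x, IsPath D.src x (D.faces.get k) x := by
      rcases List.mem_cons.1 (List.get_mem D.faces k) with h | h
      · obtain ⟨x, hx⟩ := D.path_outer
        rw [h]
        exact ⟨x, hx.invRev⟩
      · exact D.path_face _ h
    obtain ⟨x, hx⟩ := this
    exact hx.cyc_succ (hne _ (List.get_mem _ _)) t
  euler := by
    have h1 : Fintype.card {d // d ∈ (usedEdges D.o D.fs).toFinset}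
        = (usedEdges D.o D.fs).length := by
      rw [Fintype.card_coe, List.toFinset_card_of_nodup D.nodup]
    have h2 : (Finset.univ.image fun p : {d // d ∈ (usedEdges D.o D.fs).toFinset} => D.src p.1)
        = ((usedEdges D.o D.fs).map D.src).toFinset := by
      ext x
      simp only [Finset.mem_image, Finset.mem_univ, true_and, Subtype.exists, List.mem_toFinset,
        List.mem_map, exists_prop]
    rw [h1, h2, Fintype.card_fin]
    exact D.euler

end Diagram

/-- Reading a cyclic word from another starting point yields a conjugate element. -/
theorem exists_mk_map_cyc {α : Type*} {l : List (α × Bool)} (hl : l ≠ []) (x : ℤ) :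
    ∃ z : FreeGroup α,
      FreeGroup.mk ((List.range l.length).map fun s : ℕ => cyc l hl (x + s))
        = z⁻¹ * FreeGroup.mk l * z := by
  obtain ⟨k, hk⟩ := map_cyc_prefix hl x le_rfl
  rw [hk.eq_of_length (by simp)]
  have h : FreeGroup.mk l = FreeGroup.mk (l.take (k % l.length)) *
      FreeGroup.mk (l.drop (k % l.length)) := by
    rw [FreeGroup.mul_mk, List.take_append_drop]
  refine ⟨FreeGroup.mk (l.take (k % l.length)), ?_⟩
  rw [List.rotate_eq_drop_append_take_mod, ← FreeGroup.mul_mk, h]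
  group

theorem range_map_cons {A : Type*} (f : ℕ → A) {n : ℕ} (hn : 0 < n) :
    (List.range n).map f = f 0 :: (List.range (n - 1)).map fun s => f (s + 1) := by
  obtain ⟨n, rfl⟩ := Nat.exists_eq_succ_of_ne_zero hn.ne'
  simp [List.range_succ_eq_map, Function.comp_def]

namespace Diagram

variable {α : Type*} (D : Diagram α)

/-- The outer face. -/
def outer : Fin D.faces.length := ⟨0, by simp [faces]⟩

theorem get_outer : D.faces.get D.outer = invRev D.o := rfl

theorem get_mem_fs {k : Fin D.faces.length} (hk : k ≠ D.outer) : D.faces.get k ∈ D.fs := by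
  obtain ⟨k, hk'⟩ := k
  cases k with
  | zero => exact absurd rfl hk
  | succ k => exact List.getElem_mem _

/-- The element of a free group obtained from a path after replacing the labels of an edge. -/
theorem lift_relabel {d₀ : ℕ × Bool} {B : FreeGroup α}
    {h : FreeGroup ℕ →* FreeGroup α}
    (hh : h = FreeGroup.lift fun a =>
      if a = d₀.1 then (if d₀.2 then B else B⁻¹) else FreeGroup.mk [D.lab (a, true)]) :
    h (FreeGroup.mk [d₀]) = B ∧ h (FreeGroup.mk [flip d₀]) = B⁻¹ ∧
      ∀ l : List (ℕ × Bool), (∀ d ∈ l, d ≠ d₀ ∧ d ≠ flip d₀) →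
        h (FreeGroup.mk l) = FreeGroup.mk (l.map D.lab) := by
  have h0 : h (FreeGroup.mk [d₀]) = B := by
    obtain ⟨a, b⟩ := d₀
    subst hh
    cases b <;> simp
  refine ⟨h0, ?_, fun l hl => ?_⟩
  · rw [← h0, ← map_inv, FreeGroup.inv_mk]
    rfl
  · induction l with
    | nil => simp [FreeGroup.one_eq_mk.symm]
    | cons d l ih =>
      have h1 : FreeGroup.mk (d :: l) = FreeGroup.mk [d] * FreeGroup.mk l := by simp
      have h2 : FreeGroup.mk ((d :: l).map D.lab) =
          FreeGroup.mk [D.lab d] * FreeGroup.mk (l.map D.lab) := by simp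
      rw [h1, h2, map_mul, ih fun d hd => hl d (by simp [hd])]
      congr 1
      have hd : d.1 ≠ d₀.1 := by
        intro hd
        obtain ⟨h3, h4⟩ := hl d (by simp)
        by_cases h5 : d.2 = d₀.2
        · exact h3 (Prod.ext hd h5)
        · refine h4 (Prod.ext hd ?_)
          exact Bool.eq_not.2 h5
      obtain ⟨a, b⟩ := d
      subst hh
      have hd' : a ≠ d₀.1 := hd
      cases b
      · have := D.lab_flip (a, true)
        simp only [flip, Bool.not_true] at this
        simp [this, hd', FreeGroup.inv_mk, FreeGroup.invRev]
      · simp [hd']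

/-- In a diagram with the least number of faces, there are no two faces with mutually inverse
boundary labels meeting along corresponding edges. -/
theorem not_mirror (hne : ∀ f ∈ D.faces, f ≠ []) {u : FreeGroup α}
    (hfs : ∀ f ∈ D.fs, FreeGroup.mk (f.map D.lab) = u ∨ FreeGroup.mk (f.map D.lab) = u⁻¹)
    (hmin : ∀ ys : List (FreeGroup α), (∀ y ∈ ys, y = u ∨ y = u⁻¹) →
      ConjProd ys (FreeGroup.mk (D.o.map D.lab)) → D.fs.length ≤ ys.length)
    {k g : Fin D.faces.length} (hk : k ≠ D.outer) (hg : g ≠ D.outer) (hkg : k ≠ g)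
    (hlen : (D.faces.get k).length = (D.faces.get g).length) {t₁ t₂ : ℤ}
    (h : (D.gluing hne).inv ((D.gluing hne).dart k t₁) = (D.gluing hne).dart g t₂) :
    ¬ ∀ s : ℤ, D.lab (cyc (D.faces.get g) (hne _ (List.get_mem _ _)) (t₂ + s)) =
      flip (D.lab (cyc (D.faces.get k) (hne _ (List.get_mem _ _)) (t₁ - s))) := by
  classical
  intro hmir
  have hkne := hne _ (List.get_mem _ k)
  have hgne := hne _ (List.get_mem _ g)
  set fk := D.faces.get k with hfk
  set fg := D.faces.get g with hfg
  set d₀ := cyc fk hkne t₁ with hd₀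
  have hd₀g : flip d₀ = cyc fg hgne t₂ := congrArg Subtype.val h
  -- the positions at which the edge occurs
  have occ : ∀ k' t, cyc (D.faces.get k') (hne _ (List.get_mem _ k')) t = d₀ →
      k' = k ∧ (fk.length : ℤ) ∣ t₁ - t := fun k' t ht => by
    have := ((D.gluing hne).dart_eq_iff k' k t t₁).1 (Subtype.ext ht)
    obtain ⟨rfl, h'⟩ := this
    exact ⟨rfl, h'⟩
  have occ' : ∀ k' t, cyc (D.faces.get k') (hne _ (List.get_mem _ k')) t = flip d₀ →
      k' = g ∧ (fg.length : ℤ) ∣ t₂ - t := fun k' t ht => by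
    have := ((D.gluing hne).dart_eq_iff k' g t t₂).1 (Subtype.ext (ht.trans hd₀g))
    obtain ⟨rfl, h'⟩ := this
    exact ⟨rfl, h'⟩
  have occ_of_ne : ∀ k', k' ≠ k → k' ≠ g → ∀ d ∈ D.faces.get k', d ≠ d₀ ∧ d ≠ flip d₀ := by
    intro k' h1 h2 d hd
    obtain ⟨t, rfl⟩ := exists_cyc_eq (hne _ (List.get_mem _ k')) hd
    exact ⟨fun h => h1 (occ _ _ h).1, fun h => h2 (occ' _ _ h).1⟩
  have hpos : 0 < fk.length := List.length_pos_iff.2 hkne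
  set A := (List.range (fk.length - 1)).map fun s : ℕ => cyc fk hkne (t₁ + (s + 1 : ℕ)) with hA
  set A' := (List.range (fg.length - 1)).map fun s : ℕ => cyc fg hgne (t₂ + (s + 1 : ℕ)) with hA'
  have hndvd : ∀ s : ℕ, s + 1 < fk.length → ¬ (fk.length : ℤ) ∣ -(s + 1 : ℕ) := by
    intro s hs h
    rw [dvd_neg, Int.natCast_dvd_natCast] at h
    exact absurd (Nat.le_of_dvd (by omega) h) (by omega)
  have hAd : ∀ d ∈ A, d ≠ d₀ ∧ d ≠ flip d₀ := by
    intro d hd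
    obtain ⟨s, hs, rfl⟩ := List.mem_map.1 hd
    rw [List.mem_range] at hs
    refine ⟨fun h => ?_, fun h => hkg (occ' _ _ h).1⟩
    have := (occ _ _ h).2
    rw [sub_add_cancel_left] at this
    exact hndvd s (by omega) this
  have hAd' : ∀ d ∈ A', d ≠ d₀ ∧ d ≠ flip d₀ := by
    intro d hd
    obtain ⟨s, hs, rfl⟩ := List.mem_map.1 hd
    rw [List.mem_range] at hs
    refine ⟨fun h => hkg (occ _ _ h).1.symm, fun h => ?_⟩
    have := (occ' _ _ h).2
    rw [sub_add_cancel_left, ← hlen] at this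
    exact hndvd s (by omega) this
  have hAA : A'.map D.lab = invRev (A.map D.lab) := by
    refine List.ext_getElem (by simp [hA, hA', hlen]) fun i h1 h2 => ?_
    have hi : i < fg.length - 1 := by simpa [hA'] using h1
    simp only [hA, hA', invRev_eq, List.getElem_map, List.getElem_range, List.getElem_reverse,
      List.length_map, List.length_range]
    rw [hmir]
    congr 2
    refine cyc_congr hkne ⟨1, ?_⟩
    omega
  set B := (FreeGroup.mk (A.map D.lab))⁻¹ with hB
  obtain ⟨φ1, φ2, φ3⟩ := D.lift_relabel (d₀ := d₀) (B := B) rfl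
  set φ : FreeGroup ℕ →* FreeGroup α := FreeGroup.lift fun a =>
      if a = d₀.1 then (if d₀.2 then B else B⁻¹) else FreeGroup.mk [D.lab (a, true)]
  have hφk : φ (FreeGroup.mk fk) = 1 := by
    obtain ⟨z, hz⟩ := exists_mk_map_cyc hkne t₁
    have h1 : φ (FreeGroup.mk ((List.range fk.length).map fun s : ℕ => cyc fk hkne (t₁ + s))) = 1 := by
      rw [range_map_cons _ hpos]
      have h2 : FreeGroup.mk (d₀ :: A) = FreeGroup.mk [d₀] * FreeGroup.mk A := by simp
      have h3 : cyc fk hkne (t₁ + ((0 : ℕ) : ℤ)) = d₀ := by simp [hd₀]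
      rw [h3, h2, map_mul, φ1, φ3 A hAd, hB, inv_mul_cancel]
    rw [hz] at h1
    simpa [mul_assoc] using congrArg (fun y => φ z * y * (φ z)⁻¹) h1
  have hφg : φ (FreeGroup.mk fg) = 1 := by
    obtain ⟨z, hz⟩ := exists_mk_map_cyc hgne t₂
    have h1 : φ (FreeGroup.mk ((List.range fg.length).map fun s : ℕ => cyc fg hgne (t₂ + s))) = 1 := by
      rw [range_map_cons _ (hlen ▸ hpos)]
      have h2 : FreeGroup.mk (flip d₀ :: A') = FreeGroup.mk [flip d₀] * FreeGroup.mk A' := by simp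
      have h3 : cyc fg hgne (t₂ + ((0 : ℕ) : ℤ)) = flip d₀ := by simp [hd₀g]
      rw [h3, h2, map_mul, φ2, φ3 A' hAd', hAA, hB, ← FreeGroup.inv_mk, inv_inv, mul_inv_cancel]
    rw [hz] at h1
    simpa [mul_assoc] using congrArg (fun y => φ z * y * (φ z)⁻¹) h1
  have hφo : φ (FreeGroup.mk D.o) = FreeGroup.mk (D.o.map D.lab) := by
    refine φ3 _ fun d hd => ?_
    have := occ_of_ne D.outer hk.symm hg.symm (flip d) (by
      rw [get_outer, mem_invRev, flip_flip]; exact hd)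
    exact ⟨fun h => this.2 (by rw [h]), fun h => this.1 (by rw [h, flip_flip])⟩
  have hcp := (D.conjProd.map φ).filter_ne_one
  rw [hφo] at hcp
  have hlt := hmin _ ?_ hcp
  · refine absurd hlt (not_le.2 ?_)
    have h1 : ((D.fs.map FreeGroup.mk).map φ).length = D.fs.length := by simp
    rw [← h1, List.length_filter_lt_length_iff_exists]
    exact ⟨1, List.mem_map.2 ⟨_, List.mem_map_of_mem (D.get_mem_fs hk), hφk⟩, by simp⟩
  · intro y hy
    obtain ⟨hy, hy1⟩ := List.mem_filter.1 hy
    obtain ⟨_, hx, rfl⟩ := List.mem_map.1 hy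
    obtain ⟨f, hf, rfl⟩ := List.mem_map.1 hx
    obtain ⟨k', rfl⟩ := List.get_of_mem (List.mem_cons_of_mem (invRev D.o) hf)
    have h1 : k' ≠ k := by
      rintro rfl
      simp at hy1
      exact hy1 hφk
    have h2 : k' ≠ g := by
      rintro rfl
      simp at hy1
      exact hy1 hφg
    change φ (FreeGroup.mk (D.faces.get k')) = u ∨ φ (FreeGroup.mk (D.faces.get k')) = u⁻¹
    rw [φ3 _ (occ_of_ne k' h1 h2)]
    exact hfs _ hf

end Diagram

/-! ### The letters of `u_s` -/

/-- The `i`-th letter of the bi-infinite word with period `u_s`, where `s = q / p`. -/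
def ulab (p q : ℕ) (i : ℤ) : Fin 2 × Bool :=
  (if Even i then 0 else 1, decide (Even (i * q / p)))

section ulab

variable {p q : ℕ}

theorem ulab_fst_eq_iff {i j : ℤ} : (ulab p q i).1 = (ulab p q j).1 ↔ (Even i ↔ Even j) := by
  by_cases hi : Even i <;> by_cases hj : Even j <;> simp [ulab, hi, hj]

theorem ulab_succ_fst_ne (i : ℤ) : (ulab p q (i + 1)).1 ≠ (ulab p q i).1 := by
  rw [Ne, ulab_fst_eq_iff, Int.even_add_one]
  tauto

theorem ulab_eq_iff {i j : ℤ} : ulab p q i = ulab p q j ↔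
    (Even i ↔ Even j) ∧ (Even (i * q / p) ↔ Even (j * q / p)) := by
  rw [Prod.ext_iff, ulab_fst_eq_iff]
  simp [ulab]

theorem ulab_eq_flip_iff {i j : ℤ} : ulab p q i = flip (ulab p q j) ↔
    (Even i ↔ Even j) ∧ (Even (i * q / p) ↔ ¬ Even (j * q / p)) := by
  rw [Prod.ext_iff, flip_fst, ulab_fst_eq_iff]
  simp only [ulab, flip]
  by_cases h : Even (j * q / p : ℤ) <;> simp [h]

theorem ulab_congr (hp : 0 < p) {i j : ℤ} (h : (2 * p : ℤ) ∣ j - i) :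
    ulab p q i = ulab p q j := by
  obtain ⟨c, hc⟩ := h
  obtain rfl : j = i + 2 * p * c := by omega
  have h1 : (i + 2 * p * c) * q / p = i * q / p + 2 * (c * q) := by
    rw [show (i + 2 * p * c) * q = i * q + 2 * (c * q) * p by ring,
      Int.add_mul_ediv_right _ _ (by exact_mod_cast hp.ne')]
  rw [ulab_eq_iff, h1]
  simp [Int.even_add, mul_assoc]

/-- The positions of the two types of marked letters. -/
def IsMark (p q : ℕ) (τ : Fin 2) (i : ℤ) : Prop := (p : ℤ) ∣ if τ = 0 then i else i * q + 1

theorem isMark_add_mul {τ : Fin 2} {i : ℤ} (h : IsMark p q τ i) (c : ℤ) :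
    IsMark p q τ (i + p * c) := by
  unfold IsMark at *
  split_ifs at h ⊢
  · exact dvd_add h (dvd_mul_right _ _)
  · rw [show (i + p * c) * q + 1 = i * q + 1 + p * (c * q) by ring]
    exact dvd_add h (dvd_mul_right _ _)

theorem exists_isMark (hp : 0 < p) (hpq : q.Coprime p) (τ : Fin 2) (x : ℤ) :
    ∃ i, x ≤ i ∧ i < x + p ∧ IsMark p q τ i := by
  obtain ⟨i, hi⟩ : ∃ i, IsMark p q τ i := by
    by_cases hτ : τ = 0
    · exact ⟨0, by simp [IsMark, hτ]⟩
    · obtain ⟨a, b, hab⟩ := Nat.isCoprime_iff_coprime.2 hpq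
      refine ⟨-a, ?_⟩
      rw [IsMark, if_neg hτ]
      exact ⟨b, by linarith⟩
  have hp' : (0 : ℤ) < p := by exact_mod_cast hp
  have h1 := Int.emod_nonneg (i - x) hp'.ne'
  have h2 := Int.emod_lt_of_pos (i - x) hp'
  refine ⟨x + (i - x) % p, by omega, by omega, ?_⟩
  have h3 := Int.emod_add_mul_ediv (i - x) p
  rw [show x + (i - x) % p = i + p * (-((i - x) / p)) by linarith]
  exact isMark_add_mul hi _

theorem IsMark.ediv_zero (hp : 0 < p) {i : ℤ} (h : IsMark p q 0 i) :
    ∃ c, ∀ z : ℤ, (i * q + z) / p = c + z / p ∧ (z - i * q) / p = z / p - c := by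
  obtain ⟨c, hc⟩ := h
  rw [if_pos rfl] at hc
  refine ⟨c * q, fun z => ?_⟩
  have hp' : (p : ℤ) ≠ 0 := by exact_mod_cast hp.ne'
  rw [hc]
  constructor
  · rw [show p * c * q + z = z + c * q * p by ring, Int.add_mul_ediv_right _ _ hp', add_comm]
  · rw [show z - p * c * q = z + (-(c * q)) * p by ring, Int.add_mul_ediv_right _ _ hp']
    ring

theorem IsMark.ediv_one (hp : 0 < p) {i : ℤ} (h : IsMark p q 1 i) :
    ∃ c, ∀ z : ℤ, (i * q + z) / p = c + (z - 1) / p ∧ (z - i * q) / p = (z + 1) / p - c := by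
  obtain ⟨c, hc⟩ := h
  rw [if_neg one_ne_zero] at hc
  refine ⟨c, fun z => ?_⟩
  have hp' : (p : ℤ) ≠ 0 := by exact_mod_cast hp.ne'
  obtain hc : i * q = p * c - 1 := by linarith
  rw [hc]
  constructor
  · rw [show p * c - 1 + z = z - 1 + c * p by ring, Int.add_mul_ediv_right _ _ hp', add_comm]
  · rw [show z - (p * c - 1) = z + 1 + (-c) * p by ring, Int.add_mul_ediv_right _ _ hp']
    ring

theorem ediv_sub_one_cases (hp : 0 < p) (z : ℤ) :
    (z - 1) / (p : ℤ) = z / p ∨ z = p * (z / p) ∧ (z - 1) / (p : ℤ) = z / p - 1 := by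
  have hp' : (0 : ℤ) < p := by exact_mod_cast hp
  have h1 := Int.emod_nonneg z hp'.ne'
  have h2 := Int.emod_lt_of_pos z hp'
  have h3 := Int.emod_add_mul_ediv z p
  by_cases h : z % p = 0
  · right
    refine ⟨by linarith, ?_⟩
    rw [Int.ediv_eq_iff_of_pos hp']
    constructor <;> nlinarith
  · left
    rw [Int.ediv_eq_iff_of_pos hp']
    have : 1 ≤ z % p := by omega
    constructor <;> nlinarith

theorem not_ulab_eq_flip (hp : 0 < p) {b i₀ i₁ : ℤ}
    (m₀ : IsMark p q 0 i₀) (m₁ : IsMark p q 1 i₁)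
    (h₀ : ulab p q (b - i₀) = flip (ulab p q i₀))
    (h₁ : ulab p q (b - i₁) = flip (ulab p q i₁)) : False := by
  rw [ulab_eq_flip_iff] at h₀ h₁
  obtain ⟨c₀, hc₀⟩ := m₀.ediv_zero hp
  obtain ⟨c₁, hc₁⟩ := m₁.ediv_one hp
  have e₀ := (hc₀ 0).1
  have e₁ := (hc₁ 0).1
  rw [add_zero, Int.zero_ediv, add_zero] at e₀
  rw [add_zero, zero_sub, Int.neg_one_ediv, Int.sign_natCast_of_ne_zero hp.ne'] at e₁
  rw [sub_mul, (hc₀ _).2, e₀] at h₀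
  rw [sub_mul, (hc₁ _).2, e₁] at h₁
  have hb : Even b := by
    have := h₀.1
    rw [Int.even_sub] at this
    tauto
  have k₀ : ¬ Even (b * q / p) := by
    have := h₀.2
    rw [Int.even_sub] at this
    tauto
  have k₁ : Even ((b * q + 1) / p) := by
    have := h₁.2
    rw [Int.even_sub, Int.even_add, even_neg] at this
    simp only [Int.not_even_one] at this
    tauto
  rcases ediv_sub_one_cases hp (b * q + 1) with h | ⟨h, -⟩
  · rw [add_sub_cancel_right] at h
    exact k₀ (h ▸ k₁)
  · have : Even (b * q + 1 : ℤ) := h ▸ k₁.mul_left _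
    rw [Int.even_add_one] at this
    exact this (hb.mul_right _)

theorem dvd_of_ulab_eq (hp : 0 < p) (hpq : q.Coprime p) {b i₀ i₁ : ℤ}
    (m₀ : IsMark p q 0 i₀) (m₁ : IsMark p q 1 i₁)
    (h₀ : ulab p q (i₀ + b) = ulab p q i₀)
    (h₁ : ulab p q (i₁ + b) = ulab p q i₁) : (2 * p : ℤ) ∣ b := by
  rw [ulab_eq_iff] at h₀ h₁
  obtain ⟨c₀, hc₀⟩ := m₀.ediv_zero hp
  obtain ⟨c₁, hc₁⟩ := m₁.ediv_one hp
  have e₀ := (hc₀ 0).1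
  have e₁ := (hc₁ 0).1
  rw [add_zero, Int.zero_ediv, add_zero] at e₀
  rw [add_zero, zero_sub, Int.neg_one_ediv, Int.sign_natCast_of_ne_zero hp.ne'] at e₁
  rw [add_mul, (hc₀ _).1, e₀] at h₀
  rw [add_mul, (hc₁ _).1, e₁] at h₁
  have hb : Even b := by
    have := h₀.1
    rw [Int.even_add] at this
    tauto
  have k₀ : Even (b * q / p) := by
    have := h₀.2
    rw [Int.even_add] at this
    tauto
  have k₁ : ¬ Even ((b * q - 1) / p) := by
    have := h₁.2
    rw [Int.even_add, Int.even_add, even_neg] at this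
    simp only [Int.not_even_one] at this
    tauto
  rcases ediv_sub_one_cases hp (b * q) with h | ⟨h, -⟩
  · exact absurd (h ▸ k₀) k₁
  obtain ⟨b', rfl⟩ : (p : ℤ) ∣ b :=
    (Nat.isCoprime_iff_coprime.2 hpq.symm).dvd_of_dvd_mul_right ⟨_, h⟩
  have hp' : (p : ℤ) ≠ 0 := by exact_mod_cast hp.ne'
  rw [mul_assoc, Int.mul_ediv_cancel_left _ hp', Int.even_mul] at k₀
  have hb' : Even b' := by
    rcases k₀ with k | k
    · exact k
    · rcases Int.even_mul.1 hb with h' | h'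
      · have h2 : ¬ (2 ∣ q ∧ 2 ∣ p) := fun h => by
          have := Nat.dvd_gcd h.1 h.2
          rw [hpq.gcd_eq_one] at this
          omega
        exact absurd ⟨by exact_mod_cast k.two_dvd, by exact_mod_cast h'.two_dvd⟩ h2
      · exact h'
  obtain ⟨c, rfl⟩ := hb'.two_dvd
  exact ⟨c, by ring⟩

/-- The `t`-th letter of the bi-infinite word with period `u_s` or its inverse. -/
def slab (p q : ℕ) (σ : Bool) (t : ℤ) : Fin 2 × Bool :=
  if σ then ulab p q t else flip (ulab p q (-1 - t))

/-- The position in the word `u_s` of the `t`-th letter of `u_s` or its inverse. -/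
def coord (σ : Bool) (t : ℤ) : ℤ := if σ then t else -1 - t

theorem slab_reverse_eq_flip (hp : 0 < p) (hpq : q.Coprime p) {σ σ' : Bool} {c z₀ z₁ : ℤ}
    (m₀ : IsMark p q 0 (coord σ z₀)) (m₁ : IsMark p q 1 (coord σ z₁))
    (h₀ : slab p q σ' (c - z₀) = flip (slab p q σ z₀))
    (h₁ : slab p q σ' (c - z₁) = flip (slab p q σ z₁)) :
    σ ≠ σ' ∧ ∀ z, slab p q σ' (c - z) = flip (slab p q σ z) := by
  cases σ <;> cases σ' <;> simp only [slab, coord, if_true, Bool.false_eq_true, if_false,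
    flip_flip, flip_injective.eq_iff] at m₀ m₁ h₀ h₁ ⊢
  · refine (not_ulab_eq_flip (b := -2 - c) hp m₀ m₁ ?_ ?_).elim
    · rw [← h₀, flip_flip]; congr 1; ring
    · rw [← h₁, flip_flip]; congr 1; ring
  · have hd : (2 * p : ℤ) ∣ c + 1 := by
      refine dvd_of_ulab_eq hp hpq m₀ m₁ ?_ ?_
      · rw [← h₀]; congr 1; ring
      · rw [← h₁]; congr 1; ring
    exact ⟨by simp, fun z => (ulab_congr hp (by convert hd using 1; ring)).symm⟩
  · have hd : (2 * p : ℤ) ∣ -1 - c := by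
      refine dvd_of_ulab_eq hp hpq m₀ m₁ ?_ ?_
      · rw [← h₀]; congr 1; ring
      · rw [← h₁]; congr 1; ring
    exact ⟨by simp, fun z => (ulab_congr hp (by convert hd using 1; ring)).symm⟩
  · exact (not_ulab_eq_flip (b := c) hp m₀ m₁ h₀ h₁).elim

end ulab

/-! ### Long segments of relators on the boundary -/

section

variable {p q : ℕ}

/-- The first `L` letters of the infinite word with period `u_s`. -/
def uList (p q L : ℕ) : List (Fin 2 × Bool) := (List.range L).map fun i : ℕ => ulab p q i

@[simp] theorem length_uList (L : ℕ) : (uList p q L).length = L := by simp [uList]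

theorem cyc_uList (hp : 0 < p) {L : ℕ} (h : 2 * p ∣ L) (hne : uList p q L ≠ []) (t : ℤ) :
    cyc (uList p q L) hne t = ulab p q t := by
  obtain ⟨i, hi, hdvd⟩ := exists_nat_modEq hne t
  rw [← cyc_congr hne hdvd, cyc_natCast hne hi, ← ulab_congr hp (i := i) (j := t)]
  · simp [uList]
  · rw [length_uList] at hdvd
    exact dvd_trans (by exact_mod_cast h) hdvd

theorem mk_uList_pow (hp : 0 < p) (n : ℕ) :
    FreeGroup.mk (uList p q (2 * p)) ^ n = FreeGroup.mk (uList p q (n * (2 * p))) := by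
  induction n with
  | zero => simp [uList, FreeGroup.one_eq_mk]
  | succ n ih =>
    rw [pow_succ, ih, FreeGroup.mul_mk, Nat.add_mul, one_mul]
    congr 1
    unfold uList
    rw [List.range_add, List.map_append, List.map_map]
    congr 2
    funext i
    refine ulab_congr hp ⟨n, ?_⟩
    push_cast
    ring

theorem toWord_mk_uList (L : ℕ) : (FreeGroup.mk (uList p q L)).toWord = uList p q L := by
  rw [FreeGroup.toWord_mk]
  refine FreeGroup.IsReduced.reduce_eq ?_
  rw [FreeGroup.IsReduced, List.isChain_iff_getElem]
  intro i hi h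
  simp only [uList, List.getElem_map, List.getElem_range, Nat.cast_add, Nat.cast_one] at h
  exact absurd h.symm (ulab_succ_fst_ne _)

theorem CycAlternating.cyc_succ {v : List (Fin 2 × Bool)} (h : CycAlternating v) (hv : v ≠ [])
    (t : ℤ) : (cyc v hv (t + 1)).1 ≠ (cyc v hv t).1 := by
  obtain ⟨i, hi, hdvd⟩ := exists_nat_modEq hv t
  have h1 := (h ⟨i, hi⟩).symm
  rw [← cyc_congr hv hdvd, cyc_natCast hv hi]
  convert h1 using 2
  rw [← cyc_congr hv (s := ((i + 1) % v.length : ℕ)) (t := t + 1),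
    cyc_natCast hv (Nat.mod_lt _ (by omega))]
  · rfl
  · push_cast
    rw [show t + 1 - ((i : ℤ) + 1) % v.length = (t - i) + ((i + 1) - ((i : ℤ) + 1) % v.length)
      by ring]
    exact dvd_add hdvd (Int.dvd_self_sub_emod)
  · rfl

theorem slab_succ_fst_ne (σ : Bool) (t : ℤ) :
    (slab p q σ (t + 1)).1 ≠ (slab p q σ t).1 := by
  cases σ
  · have := @ulab_succ_fst_ne p q (-1 - (t + 1))
    simp only [slab, Bool.false_eq_true, if_false, flip_fst]
    rw [show -1 - (t + 1) + 1 = -1 - t by ring] at this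
    exact this.symm
  · simpa [slab] using ulab_succ_fst_ne t

theorem exists_isMark_coord (hp : 0 < p) (hpq : q.Coprime p) (σ : Bool) (τ : Fin 2) (x : ℤ) :
    ∃ i, x ≤ i ∧ i < x + p ∧ IsMark p q τ (coord σ i) := by
  cases σ
  · obtain ⟨i, h1, h2, h3⟩ := exists_isMark hp hpq τ (-x - p)
    refine ⟨-1 - i, by omega, by omega, ?_⟩
    simpa [coord] using h3
  · simpa [coord] using exists_isMark hp hpq τ x

theorem isMark_coord_add {σ : Bool} {τ : Fin 2} {i : ℤ} (h : IsMark p q τ (coord σ i)) :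
    IsMark p q τ (coord σ (i + p)) := by
  cases σ
  · have := isMark_add_mul h (-1)
    simp only [coord, Bool.false_eq_true, if_false] at this ⊢
    convert this using 1
    ring
  · have := isMark_add_mul h 1
    simp only [coord, if_true] at this ⊢
    convert this using 1
    ring

theorem exists_segment_of_mem_normalClosure (hp : 0 < p) (hpq : q.Coprime p) {n : ℕ} (hn : 2 ≤ n)
    {v : List (Fin 2 × Bool)} (hv : v ≠ []) (halt : CycAlternating v)
    (hmem : FreeGroup.mk v ∈
      Subgroup.normalClosure {FreeGroup.mk (uList p q (n * (2 * p)))}) :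
    ∃ σ τ X x, IsMark p q τ (coord σ X) ∧ (2 * n - 1) * p < v.length ∧
      ∀ s : ℕ, s ≤ (2 * n - 1) * p → cyc v hv (x + s) = slab p q σ (X + s) := by
  classical
  set u := FreeGroup.mk (uList p q (n * (2 * p))) with hu
  have hex : ∃ k, ∃ xs : List F, xs.length = k ∧ (∀ x ∈ xs, x = u ∨ x = u⁻¹) ∧
      ConjProd xs (FreeGroup.mk v) := by
    obtain ⟨xs, h1, h2⟩ := ConjProd.exists_of_mem_normalClosure hmem
    exact ⟨_, xs, rfl, h1, h2⟩
  obtain ⟨xs, hxs, hxu, hconj⟩ := Nat.find_spec hex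
  have hmin : ∀ ys : List F, (∀ y ∈ ys, y = u ∨ y = u⁻¹) → ConjProd ys (FreeGroup.mk v) →
      xs.length ≤ ys.length := fun ys h1 h2 => hxs ▸ Nat.find_min' hex ⟨ys, rfl, h1, h2⟩
  have hL : 0 < n * (2 * p) := by positivity
  have hne0 : uList p q (n * (2 * p)) ≠ [] := by
    rw [← List.length_pos_iff, length_uList]
    exact hL
  obtain ⟨D, hDo, hDf⟩ := Bounds.of_conjProd (Rs := xs.map FreeGroup.toWord) hv (by
    rw [List.map_map]
    convert hconj
    conv_rhs => rw [← List.map_id xs]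
    exact List.map_congr_left fun x _ => FreeGroup.mk_toWord)
  have hface : ∀ f ∈ D.fs, (FreeGroup.mk (f.map D.lab) = u ∨ FreeGroup.mk (f.map D.lab) = u⁻¹) ∧
      (f.map D.lab = uList p q (n * (2 * p)) ∨
        f.map D.lab = invRev (uList p q (n * (2 * p)))) := by
    intro f hf
    have h1 : f.map D.lab ∈ xs.map FreeGroup.toWord := hDf ▸ List.mem_map_of_mem hf
    obtain ⟨x, hx, hxf⟩ := List.mem_map.1 h1
    rw [← hxf, FreeGroup.mk_toWord]
    refine ⟨hxu x hx, ?_⟩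
    rcases hxu x hx with rfl | rfl
    · exact Or.inl (toWord_mk_uList _)
    · rw [FreeGroup.toWord_inv, toWord_mk_uList]
      exact Or.inr rfl
  have hflen : ∀ f ∈ D.fs, f.length = n * (2 * p) := by
    intro f hf
    rw [← List.length_map (f := D.lab)]
    rcases (hface f hf).2 with h | h <;> simp [h]
  have hne : ∀ f ∈ D.faces, f ≠ [] := by
    intro f hf
    rcases List.mem_cons.1 hf with rfl | hf
    · rw [← List.length_pos_iff, FreeGroup.invRev_length, ← List.length_map (f := D.lab), hDo]
      exact List.length_pos_iff.2 hv
    · rw [← List.length_pos_iff, hflen f hf]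
      exact hL
  have hsgn : ∀ k : Fin D.faces.length, ∃ σ : Bool, k ≠ D.outer →
      ∀ t, D.lab (cyc (D.faces.get k) (hne _ (List.get_mem _ _)) t) = slab p q σ t := by
    intro k
    by_cases hk : k = D.outer
    · exact ⟨true, fun h => absurd hk h⟩
    have hd : 2 * p ∣ n * (2 * p) := dvd_mul_left _ _
    rcases (hface _ (D.get_mem_fs hk)).2 with h | h
    · refine ⟨true, fun _ t => ?_⟩
      rw [map_cyc D.lab]
      simp only [h, cyc_uList hp hd, slab, if_true]
    · refine ⟨false, fun _ t => ?_⟩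
      rw [map_cyc D.lab]
      simp only [h]
      rw [cyc_invRev hne0, cyc_uList hp hd]
      simp [slab]
  choose sgn hsgn using hsgn
  have hout : ∀ t, D.lab (cyc (D.faces.get D.outer) (hne _ (List.get_mem _ _)) t)
      = flip (cyc v hv (-1 - t)) := by
    intro t
    rw [map_cyc D.lab]
    simp only [D.get_outer, map_invRev D.lab D.lab_flip, hDo]
    rw [cyc_invRev hv]
  set G := D.gluing hne with hG
  have hGlab : ∀ k ≠ D.outer, ∀ t, D.lab (G.dart k t).1 = slab p q (sgn k) t := fun k hk t =>
    hsgn k hk t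
  have hGout : ∀ t, D.lab (G.dart D.outer t).1 = flip (cyc v hv (-1 - t)) := hout
  have hGinv : ∀ d, D.lab (G.inv d).1 = flip (D.lab d.1) := fun d => D.lab_flip _
  obtain ⟨k, hk, τ, X, y, hX, hseg⟩ := G.exists_long_segment D.outer (fun d => (D.lab d.1).1)
    (by
      intro d
      by_cases hd : G.face d = D.outer
      · rw [← G.dart_face_idx d, G.next_dart, hd, hGout, hGout, flip_fst, flip_fst]
        rw [show -1 - G.idx d = -1 - (G.idx d + 1) + 1 by ring]
        exact (halt.cyc_succ hv _).symm
      · rw [← G.dart_face_idx d, G.next_dart, hGlab _ hd, hGlab _ hd]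
        exact slab_succ_fst_ne _ _)
    (by
      intro d
      rw [hGinv, flip_fst])
    (p := p) (N := 2 * n) hp (by omega)
    (by
      intro k hk
      exact (hflen _ (D.get_mem_fs hk)).trans (by ring))
    (fun k τ t => IsMark p q τ (coord (sgn k) t))
    (fun k _ τ x => exists_isMark_coord hp hpq _ _ _)
    (fun k _ τ i h => isMark_coord_add h)
    (by
      intro k hk g hg x y T h hτ
      obtain ⟨z₀, h1, h2, m₀⟩ := hτ 0
      obtain ⟨z₁, h3, h4, m₁⟩ := hτ 1
      have key : ∀ z, x ≤ z → z ≤ x + T →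
          slab p q (sgn g) (x + y + T - z) = flip (slab p q (sgn k) z) := by
        intro z hz hz'
        have h5 := h (x + T - z).toNat (by omega)
        rw [Int.toNat_of_nonneg (by omega)] at h5
        have h6 := congrArg (fun d => D.lab d.1) h5
        simp only [hGinv, hGlab k hk, hGlab g hg] at h6
        rw [show x + (T : ℤ) - (x + T - z) = z by ring] at h6
        rw [h6]
        congr 1
        ring
      obtain ⟨hne', hall⟩ := slab_reverse_eq_flip hp hpq m₀ m₁ (key _ h1 h2) (key _ h3 h4)
      have h7 := h 0 (Nat.zero_le _)
      rw [Nat.cast_zero, sub_zero, add_zero] at h7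
      refine D.not_mirror hne (fun f hf => (hface f hf).1) ?_ hk hg ?_ ?_ h7 fun s => ?_
      · rw [hDo]
        intro ys h1 h2
        refine le_trans (le_of_eq ?_) (hmin ys h1 h2)
        rw [← List.length_map (f := FreeGroup.toWord) (as := xs), ← hDf, List.length_map]
      · rintro rfl
        exact hne' rfl
      · rw [hflen _ (D.get_mem_fs hk), hflen _ (D.get_mem_fs hg)]
      · rw [hsgn g hg, hsgn k hk, ← hall]
        congr 1
        ring)
  set T := (2 * n - 1) * p with hT
  refine ⟨sgn k, τ, X, -1 - y - T, hX, ?_, fun s hs => ?_⟩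
  · by_contra hlt
    have hlt : v.length ≤ T := by omega
    have h1 := hseg 0 (Nat.zero_le _)
    have h2 := hseg v.length hlt
    have h3 : G.dart D.outer (y + (0 : ℕ)) = G.dart D.outer (y + v.length) := by
      rw [G.dart_eq_iff]
      refine ⟨rfl, ?_⟩
      have : G.len D.outer = v.length := by
        change (invRev D.o).length = _
        rw [FreeGroup.invRev_length, ← List.length_map (f := D.lab), hDo]
      rw [this]
      simp
    rw [← h1, ← h2] at h3
    have h4 := congrArg G.inv h3
    rw [G.inv_inv, G.inv_inv, G.dart_eq_iff] at h4
    have h5 : G.len k = n * (2 * p) := hflen _ (D.get_mem_fs hk)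
    have h6 := h4.2
    rw [h5, Nat.cast_zero, show X + (T : ℤ) - (v.length : ℤ) - (X + T - 0) = -(v.length : ℤ) by ring,
      dvd_neg, Int.natCast_dvd_natCast] at h6
    have h7 := Nat.le_of_dvd (List.length_pos_iff.2 hv) h6
    have h8 : T + p = n * (2 * p) := by
      rw [hT]
      obtain ⟨n, rfl⟩ := Nat.exists_eq_add_of_le hn
      rw [show 2 * (2 + n) - 1 = 2 * n + 3 by omega]
      ring
    omega
  · have h1 := congrArg (fun d => D.lab d.1) (hseg (T - s) (by omega))
    simp only [hGinv, hGlab k hk, hGout, flip_injective.eq_iff] at h1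
    rw [Nat.cast_sub hs] at h1
    rw [show X + (s : ℤ) = X + T - (T - s) by ring, h1]
    congr 1
    ring

end

/-! ### Run lengths -/

section RunLengths

variable {α β : Type} [BEq α] [LawfulBEq α] [BEq β] [LawfulBEq β]

theorem runLengths_append {l m : List α} (h : ∀ x ∈ l.getLast?, ∀ y ∈ m.head?, x ≠ y) :
    runLengths (l ++ m) = runLengths l ++ runLengths m := by
  rw [runLengths, List.splitBy_append fun x hx y hy => beq_eq_false_iff_ne.2 (h x hx y hy),
    List.map_append]
  rfl

theorem runLengths_map {f : α → β} (hf : Function.Injective f) (l : List α) :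
    runLengths (l.map f) = runLengths l := by
  have hb : ∀ x y, (f x == f y) = (x == y) := fun x y => by
    rw [Bool.eq_iff_iff, beq_iff_eq, beq_iff_eq, hf.eq_iff]
  have h : (l.map f).splitBy (· == ·) = (l.splitBy (· == ·)).map (List.map f) := by
    rw [List.splitBy_eq_iff]
    refine ⟨by rw [← List.map_flatten, List.flatten_splitBy], ?_, ?_, ?_⟩
    · intro h
      obtain ⟨m, hm, h⟩ := List.mem_map.1 h
      rw [List.map_eq_nil_iff] at h
      exact List.nil_notMem_splitBy _ _ (h ▸ hm)
    · intro m' hm'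
      obtain ⟨m, hm, rfl⟩ := List.mem_map.1 hm'
      rw [List.isChain_map]
      simpa only [hb] using List.isChain_of_mem_splitBy hm
    · rw [List.isChain_map]
      refine (List.isChain_getLast_head_splitBy (· == ·) l).imp fun a b hab => ?_
      obtain ⟨ha, hb', hab⟩ := hab
      refine ⟨by simpa using ha, by simpa using hb', ?_⟩
      rw [List.getLast_map, List.head_map, hb]
      exact hab
  rw [runLengths, h, List.map_map, runLengths]
  exact List.map_congr_left fun m _ => by simp

theorem runLengths_reverse (l : List α) : runLengths l.reverse = (runLengths l).reverse := by
  have h : l.reverse.splitBy (· == ·) = ((l.splitBy (· == ·)).map List.reverse).reverse := by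
    rw [List.splitBy_eq_iff]
    refine ⟨by rw [← List.reverse_flatten, List.flatten_splitBy], ?_, ?_, ?_⟩
    · intro h
      obtain ⟨m, hm, h⟩ := List.mem_map.1 (List.mem_reverse.1 h)
      rw [List.reverse_eq_nil_iff] at h
      exact List.nil_notMem_splitBy _ _ (h ▸ hm)
    · intro m' hm'
      obtain ⟨m, hm, rfl⟩ := List.mem_map.1 (List.mem_reverse.1 hm')
      rw [List.isChain_reverse]
      refine (List.isChain_of_mem_splitBy hm).imp fun a b hab => ?_
      exact (beq_iff_eq.1 hab) ▸ BEq.rfl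
    · rw [List.isChain_reverse, List.isChain_map]
      refine (List.isChain_getLast_head_splitBy (· == ·) l).imp fun a b hab => ?_
      obtain ⟨ha, hb', hab⟩ := hab
      refine ⟨by simpa using hb', by simpa using ha, ?_⟩
      rw [List.getLast_reverse, List.head_reverse]
      exact beq_eq_false_iff_ne.2 (beq_eq_false_iff_ne.1 hab).symm
  rw [runLengths, h, List.map_reverse, List.map_map, runLengths]
  congr 1
  exact List.map_congr_left fun m _ => by simp

end RunLengths

theorem reverse_rep2 {T T' : List ℕ} (h : T.reverse = T) (h' : T'.reverse = T') (d : ℕ) :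
    (rep2 d T T').reverse = rep2 d T' T := by
  rw [rep2, List.reverse_flatten, List.map_replicate, List.reverse_replicate, List.reverse_append,
    h, h', rep2]

/-! ### Run lengths of the words `u_s` -/

section

variable {p q : ℕ}

/-- The sign of the `i`-th letter of the bi-infinite word with period `u_s`. -/
def sgn (p q : ℕ) (i : ℤ) : Bool := decide (Even (i * q / p))

/-- The finite word `f a, f (a + 1), …` with `L` letters. -/
def seg (f : ℤ → Bool) (a : ℤ) (L : ℕ) : List Bool := (List.range L).map fun s : ℕ => f (a + s)

theorem runLengths_seg_add {f : ℤ → Bool} {a : ℤ} {L : ℕ} (L' : ℕ)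
    (h : f (a + L - 1) ≠ f (a + L)) :
    runLengths (seg f a (L + L')) = runLengths (seg f a L) ++ runLengths (seg f (a + L) L') := by
  have h1 : seg f a (L + L') = seg f a L ++ seg f (a + L) L' := by
    simp [seg, List.range_add, Function.comp_def, add_assoc]
  rw [h1]
  refine runLengths_append fun x hx y hy => ?_
  cases L with
  | zero => simp [seg] at hx
  | succ L =>
    cases L' with
    | zero => simp [seg] at hy
    | succ L' =>
      simp only [seg, List.range_succ, List.map_append, List.map_cons, List.map_nil,
        List.getLast?_append, List.getLast?_singleton, Option.some_or, Option.mem_def,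
        Option.some.injEq] at hx
      simp only [seg, List.range_succ_eq_map, List.map_cons, List.head?_cons, Option.mem_def,
        Option.some.injEq] at hy
      rw [← hx, ← hy]
      convert h using 2
      · push_cast; ring
      · simp

theorem reverse_seg (f : ℤ → Bool) (a : ℤ) (L : ℕ) :
    (seg f a (L + 1)).reverse = (List.range (L + 1)).map fun s : ℕ => f (a + L - s) := by
  refine List.ext_getElem (by simp [seg]) fun i h1 h2 => ?_
  simp only [seg, List.length_reverse, List.length_map, List.length_range] at h1
  simp only [seg, List.getElem_reverse, List.getElem_map, List.getElem_range, List.length_map,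
    List.length_range]
  congr 1
  omega

theorem xor_injective (b : Bool) : Function.Injective (xor b) := fun x y h => by simpa using h

theorem runLengths_map_xor (b : Bool) (f : ℤ → Bool) (g : ℕ → ℤ) (L : ℕ) :
    runLengths ((List.range L).map fun s => xor b (f (g s))) =
      runLengths ((List.range L).map fun s => f (g s)) := by
  rw [← runLengths_map (xor_injective b) ((List.range L).map fun s => f (g s)), List.map_map]
  rfl

theorem sgn_mul_add (hp : 0 < p) (c i : ℤ) :
    sgn p q (p * c + i) = xor (decide ¬ Even (c * q)) (sgn p q i) := by
  have hp' : (p : ℤ) ≠ 0 := by exact_mod_cast hp.ne'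
  rw [sgn, show (p * c + i) * q = i * q + c * q * p by ring, Int.add_mul_ediv_right _ _ hp', sgn]
  by_cases h1 : Even (c * (q : ℤ)) <;> by_cases h2 : Even (i * q / (p : ℤ)) <;>
    simp only [Int.even_add, h1, h2] <;> rfl

theorem runLengths_seg_sgn (hp : 0 < p) {a : ℤ} (ha : (p : ℤ) ∣ a) (L : ℕ) :
    runLengths (seg (sgn p q) a L) = runLengths (seg (sgn p q) 0 L) := by
  obtain ⟨c, rfl⟩ := ha
  simp only [seg, sgn_mul_add hp, zero_add]
  exact runLengths_map_xor _ _ _ _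

theorem sgn_sub_one_ne (hp : 0 < p) (hq : 0 < q) (hqp : q ≤ p) {a : ℤ} (ha : (p : ℤ) ∣ a) :
    sgn p q (a - 1) ≠ sgn p q a := by
  obtain ⟨c, rfl⟩ := ha
  have h := sgn_mul_add (q := q) hp c 0
  rw [add_zero] at h
  rw [sub_eq_add_neg, sgn_mul_add hp, h, Ne, (xor_injective _).eq_iff]
  have h1 : (-1 * q / p : ℤ) = -1 := by
    rw [Int.ediv_eq_iff_of_pos (by omega)]
    constructor <;> omega
  rw [sgn, sgn, h1]
  simp

theorem runLengths_seg_mul_add (hp : 0 < p) (hq : 0 < q) (hqp : q ≤ p) {a : ℤ}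
    (ha : (p : ℤ) ∣ a) (c L : ℕ) :
    runLengths (seg (sgn p q) a (c * p + L)) =
      (List.replicate c (runLengths (seg (sgn p q) 0 p))).flatten ++
        runLengths (seg (sgn p q) 0 L) := by
  induction c generalizing a with
  | zero => simpa using runLengths_seg_sgn hp ha L
  | succ c ih =>
    have ha' : (p : ℤ) ∣ a + p := dvd_add ha dvd_rfl
    rw [show (c + 1) * p + L = p + (c * p + L) by ring,
      runLengths_seg_add _ (sgn_sub_one_ne hp hq hqp ha'), ih ha', runLengths_seg_sgn hp ha]
    simp [List.replicate_succ]

theorem exists_sgn_add_eq (hp : 0 < p) {κ : ℤ} (h : IsMark p q 1 κ) :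
    ∃ b, ∀ s : ℤ, sgn p q (κ + s) = xor b (sgn p q (-s)) := by
  obtain ⟨c, hc⟩ := h.ediv_one hp
  refine ⟨decide (Even c), fun s => ?_⟩
  have h1 : (-s * q / p : ℤ) = -((s * q - 1) / p) - 1 := by
    have hp' : (0 : ℤ) < p := by exact_mod_cast hp
    have h1 := Int.emod_nonneg (s * q - 1) hp'.ne'
    have h2 := Int.emod_lt_of_pos (s * q - 1) hp'
    have h3 := Int.emod_add_mul_ediv (s * q - 1) p
    rw [Int.ediv_eq_iff_of_pos hp']
    constructor <;> nlinarith
  rw [sgn, sgn, add_mul, (hc _).1, h1]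
  by_cases h3 : Even c <;> by_cases h4 : Even ((s * q - 1) / (p : ℤ)) <;>
    simp only [Int.even_add, Int.even_sub, even_neg, Int.not_even_one, h3, h4] <;> rfl

theorem runLengths_slab (hp : 0 < p) (hq : 0 < q) (hqp : q ≤ p) {S1 S2 : List ℕ}
    (hdec : runLengths (seg (sgn p q) 0 (2 * p)) = S1 ++ S2 ++ S1 ++ S2)
    (h1 : S1.reverse = S1) (h2 : S2.reverse = S2) (c : ℕ) {σ : Bool} {τ : Fin 2} {X : ℤ}
    (hX : IsMark p q τ (coord σ X)) :
    let R := runLengths ((List.range (c * p + 1)).map fun s : ℕ => (slab p q σ (X + s)).2)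
    R = rep2 c S1 S2 ++ [1] ∨ R = 1 :: rep2 c S2 S1 := by
  intro R
  have hρ : runLengths (seg (sgn p q) 0 p) = S1 ++ S2 := by
    have h := runLengths_seg_mul_add (q := q) hp hq hqp (dvd_zero (p : ℤ)) 2 0
    rw [add_zero, hdec] at h
    have h3 : (S1 ++ S2) ++ (S1 ++ S2) =
        runLengths (seg (sgn p q) 0 p) ++ runLengths (seg (sgn p q) 0 p) := by
      simpa [List.replicate_succ, seg, runLengths] using h
    refine (List.append_inj h3 ?_).1.symm
    have := congrArg List.length h3
    simp only [List.length_append] at this ⊢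
    omega
  have hfwd : ∀ a : ℤ, (p : ℤ) ∣ a →
      runLengths (seg (sgn p q) a (c * p + 1)) = rep2 c S1 S2 ++ [1] := by
    intro a ha
    rw [runLengths_seg_mul_add hp hq hqp ha, hρ, rep2]
    congr 1
  have hbwd : ∀ a : ℤ, (p : ℤ) ∣ a →
      runLengths ((List.range (c * p + 1)).map fun s : ℕ => sgn p q (a - s)) =
        1 :: rep2 c S2 S1 := by
    intro a ha
    have h := reverse_seg (sgn p q) (a - (c * p : ℕ)) (c * p)
    simp only [sub_add_cancel] at h
    rw [← h, runLengths_reverse, hfwd _ (dvd_sub ha (by simp)), List.reverse_append,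
      reverse_rep2 h1 h2]
    rfl
  obtain rfl | rfl : τ = 0 ∨ τ = 1 := by fin_cases τ <;> simp
  · have hX' : (p : ℤ) ∣ coord σ X := by simpa [IsMark] using hX
    cases σ
    · right
      rw [← hbwd _ hX', ← runLengths_map_xor true]
      refine congrArg runLengths (List.map_congr_left fun s _ => ?_)
      simp only [slab, coord, Bool.false_eq_true, if_false, flip, ulab, sgn, Bool.true_xor]
      rw [show -1 - (X + (s : ℤ)) = -1 - X - s by ring]
    · left
      exact hfwd _ hX'
  · obtain ⟨b, hb⟩ := exists_sgn_add_eq hp hX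
    cases σ
    · left
      rw [← hfwd 0 (dvd_zero _), seg, ← runLengths_map_xor (!b)]
      refine congrArg runLengths (List.map_congr_left fun s _ => ?_)
      have h := hb (-s)
      rw [neg_neg] at h
      simp only [slab, coord, Bool.false_eq_true, if_false, flip, ulab] at h ⊢
      rw [zero_add, Bool.not_xor, ← h, sgn]
      rw [show -1 - (X + (s : ℤ)) = -1 - X + -s by ring]
    · right
      rw [← hbwd 0 (dvd_zero _), ← runLengths_map_xor b]
      refine congrArg runLengths (List.map_congr_left fun s _ => ?_)
      have h := hb s
      simp only [slab, coord, if_true, ulab] at h ⊢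
      rw [zero_sub, ← h, sgn]

theorem slab_map_prefix (hp : 0 < p) {n : ℕ} (hn : 0 < n) (σ : Bool) (X : ℤ) {T : ℕ}
    (hT : T ≤ n * (2 * p)) :
    ∃ k, (List.range T).map (fun s : ℕ => slab p q σ (X + s)) <+:
        (uList p q (n * (2 * p))).rotate k ∨
      (List.range T).map (fun s : ℕ => slab p q σ (X + s)) <+:
        (invRev (uList p q (n * (2 * p)))).rotate k := by
  have hd : 2 * p ∣ n * (2 * p) := dvd_mul_left _ _
  have hne : uList p q (n * (2 * p)) ≠ [] := by
    rw [← List.length_pos_iff, length_uList]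
    positivity
  have hne' : invRev (uList p q (n * (2 * p))) ≠ [] := by
    rw [← List.length_pos_iff, FreeGroup.invRev_length, length_uList]
    positivity
  cases σ
  · obtain ⟨k, hk⟩ := map_cyc_prefix hne' X (T := T) (by simpa using hT)
    refine ⟨k, Or.inr ?_⟩
    convert hk using 3
    rw [cyc_invRev hne, cyc_uList hp hd]
    simp [slab]
  · obtain ⟨k, hk⟩ := map_cyc_prefix hne X (T := T) (by simpa using hT)
    refine ⟨k, Or.inl ?_⟩
    convert hk using 3
    rw [cyc_uList hp hd]
    simp [slab]

end

/-! ### Continued fractions and the words `u_r` -/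

theorem cfQ_nonneg (M : List ℕ) : 0 ≤ cfQ M := by
  induction M with
  | nil => exact le_rfl
  | cons a l ih =>
    rw [cfQ]
    positivity

theorem cfQ_pos_and_le_one {M : List ℕ} (hM : M ≠ []) (hpos : ∀ x ∈ M, 0 < x) :
    0 < cfQ M ∧ cfQ M ≤ 1 := by
  cases M with
  | nil => exact absurd rfl hM
  | cons a l =>
    have ha : (1 : ℚ) ≤ a := by exact_mod_cast hpos a (by simp)
    have hl := cfQ_nonneg l
    rw [cfQ]
    refine ⟨by positivity, ?_⟩
    rw [div_le_one (by positivity)]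
    linarith

theorem neg_one_pow_floor {r : ℚ} {q : ℕ} (hq : r.num = q) (i : ℕ) :
    (-1 : ℤ) ^ ⌊(i : ℚ) * r⌋.toNat = if sgn r.den q i then 1 else -1 := by
  have h1 : ⌊(i : ℚ) * r⌋ = (i : ℤ) * q / r.den := by
    conv_lhs => rw [← Rat.num_div_den r, hq]
    rw [← Rat.floor_intCast_div_natCast]
    congr 1
    push_cast
    ring
  rw [h1, sgn]
  have h2 : ((((i : ℤ) * q / r.den).toNat : ℕ) : ℤ) = (i : ℤ) * q / r.den :=
    Int.toNat_of_nonneg (by positivity)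
  have h3 : Even ((i : ℤ) * q / r.den) ↔ Even ((i : ℤ) * q / r.den).toNat := by
    rw [← Int.even_coe_nat, h2]
  by_cases h : Even ((i : ℤ) * q / r.den).toNat
  · rw [h.neg_one_pow, if_pos (by simpa using h3.2 h)]
  · rw [(Nat.not_even_iff_odd.1 h).neg_one_pow, if_neg (by simpa using fun h' => h (h3.1 h'))]

theorem CS_eq {r : ℚ} {q : ℕ} (hq : r.num = q) :
    CS r = runLengths (seg (sgn r.den q) 0 (2 * r.den)) := by
  have hinj : Function.Injective fun b : Bool => if b then (1 : ℤ) else -1 := by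
    intro a b
    cases a <;> cases b <;> simp
  rw [CS, ← runLengths_map hinj, signList, seg, List.map_map, bind_pure_comp, List.map_eq_map,
    List.map_map]
  refine congrArg runLengths (List.map_congr_left fun i _ => ?_)
  rw [Function.comp_apply, neg_one_pow_floor hq]
  simp

theorem uWord_eq {r : ℚ} {q : ℕ} (hq : r.num = q) :
    uWord r = FreeGroup.mk (uList r.den q (2 * r.den)) := by
  rw [uWord, uList]
  generalize 2 * r.den = L
  induction L with
  | zero => simp [FreeGroup.one_eq_mk]
  | succ L ih =>
    rw [List.range_succ, List.map_append, List.map_append, List.prod_append, ← FreeGroup.mul_mk, ih]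
    congr 1
    simp only [List.map_cons, List.map_nil, List.prod_cons, List.prod_nil, mul_one,
      neg_one_pow_floor hq, gen, ulab, sgn]
    have h1 : (⟨L % 2, Nat.mod_lt _ (by norm_num)⟩ : Fin 2) =
        if Even (L : ℤ) then 0 else 1 := by
      rcases Nat.mod_two_eq_zero_or_one L with h | h <;> simp [h, Nat.even_iff, Int.even_coe_nat]
    rw [h1]
    by_cases h : Even ((L : ℤ) * q / r.den)
    · simp [h, FreeGroup.of]
    · simp [h, FreeGroup.of, FreeGroup.inv_mk, FreeGroup.invRev]

/-- Lemma 4.1(2): if `v` is a nonempty cyclically reduced, cyclically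
alternating word representing the trivial element of `Heck(r;n)`, then the
cyclic word `(v)` contains a subword `w` of the cyclic word `(u_r^{±n})` with
`S(w) = ((2n-1)⟨S₁,S₂⟩, ℓ)` or `S(w) = (ℓ, (2n-1)⟨S₂,S₁⟩)` for some `ℓ ≥ 1`. -/
theorem statement15
    (M : List ℕ) (m n : ℕ) (r : ℚ)
    (hMlen : 2 ≤ M.length) (hMpos : ∀ x ∈ M, 0 < x) (hMlast : 2 ≤ M.getLast!)
    (hm : M.head? = some m) (hn : 2 ≤ n) (hr : r = cfQ M)
    (S1 S2 : List ℕ) (hdec : CS r = S1 ++ S2 ++ S1 ++ S2)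
    (hS1ne : S1 ≠ []) (hS2ne : S2 ≠ [])
    (hS1pal : S1.reverse = S1) (hS2pal : S2.reverse = S2)
    (hS1h : S1.head? = some (m + 1)) (hS2h : S2.head? = some m)
    (v : List (Fin 2 × Bool)) (hvne : v ≠ [])
    (hvred : CycReduced v) (hvalt : CycAlternating v)
    (hvtriv : FreeGroup.mk v ∈ heckN r n) :
    ∃ w : List (Fin 2 × Bool), ∃ ℓ : ℕ, 0 < ℓ ∧
      (∃ k, w <:+: v.rotate k) ∧
      (∃ k, w <:+: (uWord r ^ n).toWord.rotate k ∨
            w <:+: ((uWord r ^ n)⁻¹).toWord.rotate k) ∧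
      (runLengths (w.map Prod.snd) = rep2 (2 * n - 1) S1 S2 ++ [ℓ] ∨
        runLengths (w.map Prod.snd) = ℓ :: rep2 (2 * n - 1) S2 S1) := by
  obtain ⟨hr0, hr1⟩ := hr ▸ cfQ_pos_and_le_one (M := M) (by rintro rfl; simp at hMlen) hMpos
  obtain ⟨q, hq⟩ := Int.eq_ofNat_of_zero_le (Rat.num_pos.2 hr0).le
  have hp : 0 < r.den := r.den_pos
  have hq0 : 0 < q := by
    have := Rat.num_pos.2 hr0
    omega
  have hqp : q ≤ r.den := by
    rw [← Rat.num_div_den r, div_le_one (by exact_mod_cast hp), hq] at hr1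
    exact_mod_cast hr1
  have hcop : q.Coprime r.den := by simpa [hq] using r.reduced
  have hu : uWord r ^ n = FreeGroup.mk (uList r.den q (n * (2 * r.den))) := by
    rw [uWord_eq hq, mk_uList_pow hp]
  rw [heckN, hu] at hvtriv
  rw [CS_eq hq] at hdec
  obtain ⟨σ, τ, X, x, hX, hlen, hseg⟩ :=
    exists_segment_of_mem_normalClosure hp hcop hn hvne hvalt hvtriv
  obtain ⟨k, hk⟩ := map_cyc_prefix hvne x hlen
  obtain ⟨j, hj⟩ := slab_map_prefix (q := q) hp (n := n) (by omega) σ X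
    (T := (2 * n - 1) * r.den + 1) (by
      obtain ⟨n, rfl⟩ := Nat.exists_eq_add_of_le hn
      rw [show 2 * (2 + n) - 1 = 2 * n + 3 by omega]
      nlinarith)
  refine ⟨(List.range ((2 * n - 1) * r.den + 1)).map fun s : ℕ => slab r.den q σ (X + s),
    1, one_pos, ⟨k, ?_⟩, ⟨j, ?_⟩, ?_⟩
  · refine List.IsPrefix.isInfix ?_
    convert hk using 1
    refine List.map_congr_left fun s hs => (hseg s ?_).symm
    have := List.mem_range.1 hs
    omega
  · rw [hu, FreeGroup.toWord_inv, toWord_mk_uList]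
    exact hj.imp List.IsPrefix.isInfix List.IsPrefix.isInfix
  · rw [List.map_map]
    exact runLengths_slab hp hq0 hqp hdec hS1pal hS2pal _ hX

end Heckoid
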